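/- arXiv:1207.0237 — 7 statements merged into one kernel-verified Lean document; each statement's English description precedes it below -/
import Mathlib

section
/- Let G be a tournament, let v_1,…,v_n be a matching ordering of G, and suppose π ∈ S_n is such that v_{π(1)},…,v_{π(n)} is also a matching ordering of G. Then {1,…,n} can be partitioned into sets X_1,…,X_r of consecutive integers such that: (i) π = σ_1σ_2⋯σ_r where each σ_i is σ_{X_i}, σ_{X_i}^{−1}, or τ_{X_i}; (ii) for each i, the set V_i = {v_x : x ∈ X_i} is a homogeneous set of G; (iii) for each i, the subtournament H_i induced on V_i is either transitive or isomorphic to P_{|V_i|}, and the ordering induced on V_i by v_1,…,v_n is π_2 H_i if σ_i = σ_{X_i}, is π_1 H_i if σ_i = σ_{X_i}^{−1}, and is π_2 H_i or π_2π_1 H_i if σ_i = τ_{X_i}. -/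
/-- A tournament on a vertex type `V`: for any two distinct vertices exactly one of the
two possible directed edges is present. -/
structure Tournament (V : Type) where
  rel : V → V → Prop
  asymm : ∀ u v, rel u v → ¬ rel v u
  total : ∀ u v, u ≠ v → rel u v ∨ rel v u

namespace Tournament

variable {V : Type}

/-- `X` is a homogeneous set of the subtournament of `T` induced on `S`. -/
def HomogOn (T : Tournament V) (S X : Set V) : Prop :=
  X ⊆ S ∧ ∀ v ∈ S \ X, (∀ x ∈ X, T.rel v x) ∨ (∀ x ∈ X, T.rel x v)

/-- The subtournament of `T` induced on `S` is prime: it is a (nonempty) tournament all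
of whose homogeneous sets are trivial. -/
def PrimeOn (T : Tournament V) (S : Set V) : Prop :=
  S.Nonempty ∧ ∀ X : Set V, T.HomogOn S X → X.ncard ≤ 1 ∨ X = S

/-- The subtournament of `T` induced on `S` is isomorphic to the tournament on `Fin n`
with edge relation `r`. -/
def IsoOnFin (T : Tournament V) (S : Set V) {n : ℕ} (r : Fin n → Fin n → Prop) : Prop :=
  ∃ f : Fin n → V, Function.Injective f ∧ Set.range f = S ∧
    ∀ i j : Fin n, r i j ↔ T.rel (f i) (f j)

/-- `T` has a subtournament isomorphic to the tournament on `Fin n` with edge relation `r`. -/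
def HasSub (T : Tournament V) {n : ℕ} (r : Fin n → Fin n → Prop) : Prop :=
  ∃ f : Fin n → V, Function.Injective f ∧ ∀ i j : Fin n, r i j ↔ T.rel (f i) (f j)

/-- The subtournament of `T` induced on `S` has a subtournament isomorphic to the
tournament on `Fin n` with edge relation `r`. -/
def HasSubIn (T : Tournament V) (S : Set V) {n : ℕ} (r : Fin n → Fin n → Prop) : Prop :=
  ∃ f : Fin n → V, Function.Injective f ∧ (∀ i, f i ∈ S) ∧
    ∀ i j : Fin n, r i j ↔ T.rel (f i) (f j)

/-- `v ∈ Ext(H)`: `v` is outside `H` and `H + v` is prime. -/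
def mem_Ext (T : Tournament V) (H : Set V) (v : V) : Prop :=
  v ∉ H ∧ T.PrimeOn (insert v H)

/-- `v ∈ Z(H)`: `v` is outside `H` and `H` is a homogeneous set of `H + v`. -/
def mem_Z (T : Tournament V) (H : Set V) (v : V) : Prop :=
  v ∉ H ∧ T.HomogOn (insert v H) H

/-- `v ∈ V_x(H)`: `v` is outside `H` and `{v, x}` is a homogeneous set of `H + v`. -/
def mem_Vx (T : Tournament V) (H : Set V) (x v : V) : Prop :=
  v ∉ H ∧ T.HomogOn (insert v H) {v, x}

/-- `C` is (the vertex set of) a cyclic triangle of `T`. -/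
def CycTri (T : Tournament V) (C : Set V) : Prop :=
  ∃ a b c : V, C = {a, b, c} ∧ T.rel a b ∧ T.rel b c ∧ T.rel c a

/-- The cyclic triangles `C` and `C'` are triangle-connected: there is a sequence of
cyclic triangles from `C` to `C'` in which consecutive triangles share exactly two
vertices. -/
def TriConn (T : Tournament V) (C C' : Set V) : Prop :=
  ∃ m : ℕ, ∃ f : Fin (m + 1) → Set V,
    f 0 = C ∧ f (Fin.last m) = C' ∧ (∀ i, T.CycTri (f i)) ∧
    ∀ i : Fin m, ((f i.castSucc) ∩ (f i.succ)).ncard = 2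

/-- `T` is strongly connected. -/
def StronglyConnected (T : Tournament V) : Prop :=
  ∀ u v : V, Relation.ReflTransGen T.rel u v

/-- The subtournament of `T` induced on `S` is a transitive tournament. -/
def TransOn (T : Tournament V) (S : Set V) : Prop :=
  ∃ m : ℕ, ∃ f : Fin m → V, Function.Injective f ∧ Set.range f = S ∧
    ∀ i j : Fin m, i < j → T.rel (f i) (f j)

end Tournament

/-- The tournament `T_n` (`n = 2k+1` odd) on `Fin n`: `i → j` iff `j - i mod n ∈ {1, …, k}`. -/
def TTrel (n : ℕ) (i j : Fin n) : Prop :=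
  1 ≤ (j.val + n - i.val) % n ∧ (j.val + n - i.val) % n ≤ n / 2

/-- The tournament `U_n`: obtained from `T_n` by reversing all edges with both ends among
the first `k` vertices. -/
def UUrel (n : ℕ) (i j : Fin n) : Prop :=
  if i.val < n / 2 ∧ j.val < n / 2 then TTrel n j i else TTrel n i j

/-- The tournament `W_n` on `Fin n` (vertex `n-1` plays the role of `w_n`). -/
def WWrel (n : ℕ) (i j : Fin n) : Prop :=
  (i.val < j.val ∧ j.val < n - 1) ∨ (j.val = n - 1 ∧ i.val < n - 1 ∧ i.val % 2 = 1) ∨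
    (i.val = n - 1 ∧ j.val < n - 1 ∧ j.val % 2 = 0)

/-- The tournament `P_n` on `Fin n`: `i → j` iff `j - i ≥ 2` or `i = j + 1`. -/
def PPrel (n : ℕ) (i j : Fin n) : Prop := i.val + 2 ≤ j.val ∨ i.val = j.val + 1

/-- The tournament `D_4`: vertex `0` beats the cyclic triangle `{1, 2, 3}`. -/
def DDrel (i j : Fin 4) : Prop :=
  (i = 0 ∧ j ≠ 0) ∨ (i = 1 ∧ j = 2) ∨ (i = 2 ∧ j = 3) ∨ (i = 3 ∧ j = 1)

/-- The tournament `J_n` on `Fin n`: the identity ordering has exactly one backedge,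
from the last vertex to the first. -/
def JJrel (n : ℕ) (i j : Fin n) : Prop :=
  (i.val < j.val ∧ ¬(i.val = 0 ∧ j.val = n - 1)) ∨ (i.val = n - 1 ∧ j.val = 0)

/-- The tournament `K_n` on `Fin n`: the identity ordering has exactly one backedge,
from the last vertex to the second. -/
def KKrel (n : ℕ) (i j : Fin n) : Prop :=
  (i.val < j.val ∧ ¬(i.val = 1 ∧ j.val = n - 1)) ∨ (i.val = n - 1 ∧ j.val = 1)

/-- The tournament `K_n^*` on `Fin n`: the identity ordering has exactly one backedge,
from the second-to-last vertex to the first. -/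
def KKsrel (n : ℕ) (i j : Fin n) : Prop :=
  (i.val < j.val ∧ ¬(i.val = 0 ∧ j.val = n - 2)) ∨ (i.val = n - 2 ∧ j.val = 0)

/-- `(j, i)` (0-indexed, `i < j`) is one of the backedges of the defining ordering of `Q_n`. -/
def Qback (n i j : ℕ) : Prop :=
  (j = n - 2 ∧ i = 0) ∨ (j = n - 1 ∧ i = n - 3) ∨ (j = i + 1 ∧ j ≤ n - 3)

/-- The tournament `Q_n` on `Fin n`. -/
def QQrel (n : ℕ) (i j : Fin n) : Prop :=
  (i.val < j.val ∧ ¬ Qback n i.val j.val) ∨ (j.val < i.val ∧ Qback n j.val i.val)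

/-- `e` is a matching ordering of the tournament with edge relation `r` on `V`:
`e` lists all vertices and every vertex is the head or tail of at most one backedge. -/
def MatchingOrd {V : Type} (r : V → V → Prop) {m : ℕ} (e : Fin m → V) : Prop :=
  Function.Bijective e ∧
    ∀ i : Fin m, {j : Fin m | (i < j ∧ r (e j) (e i)) ∨ (j < i ∧ r (e i) (e j))}.Subsingleton

/-- `e` is a matching ordering of the subtournament induced on `S`. -/
def MatchingOrdOn {V : Type} (r : V → V → Prop) (S : Set V) {m : ℕ} (e : Fin m → V) : Prop :=
  Set.BijOn e Set.univ S ∧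
    ∀ i : Fin m, {j : Fin m | (i < j ∧ r (e j) (e i)) ∨ (j < i ∧ r (e i) (e j))}.Subsingleton

/-- The subtournament induced on `S` is a matching tournament. -/
def IsMatchingOn {V : Type} (r : V → V → Prop) (S : Set V) : Prop :=
  ∃ m : ℕ, ∃ e : Fin m → V, MatchingOrdOn r S e

/-- The permutation `σ_X` of the interval of integers `X = {b, …, a}` (identity off `X`):
the cycle `(b b+2 … a-2 a a-1 a-3 … b+1)` when `|X|` is odd and
`(b b+2 … a-1 a a-2 … b+1)` when `|X|` is even. -/
def sigmaX (b a x : ℕ) : ℕ :=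
  if x < b ∨ a < x then x
  else if a = b then x
  else if (x - b) % 2 = 0 then
    (if x + 2 ≤ a then x + 2 else if x + 1 ≤ a then x + 1 else x - 1)
  else (if b + 3 ≤ x then x - 2 else b)

/-- The permutation `τ_X = (b b+2)(b+1 b+3)` of `X = {b, b+1, b+2, b+3}`. -/
def tauX (b x : ℕ) : ℕ :=
  if x = b then b + 2 else if x = b + 2 then b
  else if x = b + 1 then b + 3 else if x = b + 3 then b + 1 else x

/-- The permutation `π_1` of the interval `{b, …, a}`: product of the transpositions
swapping the 1st and 2nd, 3rd and 4th, … elements of the interval. -/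
def pi1N (b a x : ℕ) : ℕ :=
  if x < b ∨ a < x then x
  else if (x - b) % 2 = 0 then (if x + 1 ≤ a then x + 1 else x)
  else x - 1

/-- The permutation `π_2` of the interval `{b, …, a}`: product of the transpositions
swapping the 2nd and 3rd, 4th and 5th, … elements of the interval. -/
def pi2N (b a x : ℕ) : ℕ :=
  if x < b ∨ a < x then x
  else if x = b then x
  else if (x - b) % 2 = 1 then (if x + 1 ≤ a then x + 1 else x)
  else x - 1

/-- The segment of the ordering `e` on positions `b, …, a` induces a transitive tournament,
with ordering given (relative to the standard ordering `f`) by the permutation `p`. -/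
def SegTrans {V : Type} (T : Tournament V) {n : ℕ} (e : Fin n → V) (b a : ℕ) (p : ℕ → ℕ) : Prop :=
  ∃ f : ℕ → V, (∀ x y : ℕ, b ≤ x → x < y → y ≤ a → T.rel (f x) (f y)) ∧
    ∀ i : Fin n, b ≤ i.val → i.val ≤ a → e i = f (p i.val)

/-- The segment of the ordering `e` on positions `b, …, a` induces a tournament isomorphic
to `P_m` (where `m = a - b + 1`), with ordering given (relative to the defining ordering
`f` of `P_m`) by the permutation `p`. -/
def SegP {V : Type} (T : Tournament V) {n : ℕ} (e : Fin n → V) (b a : ℕ) (p : ℕ → ℕ) : Prop :=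
  ∃ f : ℕ → V,
    (∀ x y : ℕ, b ≤ x → x ≤ a → b ≤ y → y ≤ a →
      (T.rel (f x) (f y) ↔ (x + 2 ≤ y ∨ x = y + 1))) ∧
    ∀ i : Fin n, b ≤ i.val → i.val ≤ a → e i = f (p i.val)


/-! Auxiliary material: everything is transported to natural-number positions. -/

/-- Data: two matching orderings, in terms of positions. -/
structure MPair (n : ℕ) (R : ℕ → ℕ → Prop) (p q : ℕ → ℕ) : Prop where
  pq : ∀ x, p (q x) = x
  qp : ∀ x, q (p x) = x
  out : ∀ x, n ≤ x → q x = x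
  asy : ∀ x y, R x y → ¬ R y x
  tot : ∀ x y, x < n → y < n → x ≠ y → R x y ∨ R y x
  m1 : ∀ x y z, y ≠ z → ((x < y ∧ R y x) ∨ (y < x ∧ R x y)) →
    ((x < z ∧ R z x) ∨ (z < x ∧ R x z)) → False
  m2 : ∀ x y z, y ≠ z → ((q x < q y ∧ R y x) ∨ (q y < q x ∧ R x y)) →
    ((q x < q z ∧ R z x) ∨ (q z < q x ∧ R x z)) → False

/-- The pair `x, y` is inverted. -/
def InvP (q : ℕ → ℕ) (x y : ℕ) : Prop := (x < y ∧ q y < q x) ∨ (y < x ∧ q x < q y)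

namespace MPair

variable {n : ℕ} {R : ℕ → ℕ → Prop} {p q : ℕ → ℕ}

theorem qinj (h : MPair n R p q) {x y : ℕ} (hxy : q x = q y) : x = y := by
  have := congrArg p hxy
  rwa [h.pq, h.pq] at this

theorem qlt (h : MPair n R p q) {x : ℕ} (hx : x < n) : q x < n := by
  by_contra hc
  have h1 := h.out (q x) (by omega)
  have := h.qinj h1
  omega

theorem plt (h : MPair n R p q) {x : ℕ} (hx : x < n) : p x < n := by
  by_contra hc
  have h1 := h.out (p x) (by omega)
  rw [h.qp] at h1
  omega

theorem cls (h : MPair n R p q) {x y : ℕ} (hi : InvP q x y) :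
    ((x < y ∧ R y x) ∨ (y < x ∧ R x y)) ∨ ((q x < q y ∧ R y x) ∨ (q y < q x ∧ R x y)) := by
  have hx : x < n := by
    by_contra hc
    have h1 := h.out x (by omega)
    have h2 : y < n → q y < n := h.qlt
    have h3 := h.out y
    unfold InvP at hi
    by_cases hy : y < n
    · have := h2 hy
      omega
    · have := h3 (by omega)
      omega
  have hy : y < n := by
    by_contra hc
    have h1 := h.out y (by omega)
    have h2 := h.qlt hx
    unfold InvP at hi
    omega
  unfold InvP at hi
  have := h.tot x y hx hy (by omega)
  tauto

theorem inv_symm {x y : ℕ} (hi : InvP q x y) : InvP q y x := by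
  unfold InvP at *
  omega

theorem d3 (h : MPair n R p q) {u x y z : ℕ} (hxy : x ≠ y) (hxz : x ≠ z) (hyz : y ≠ z)
    (h1 : InvP q u x) (h2 : InvP q u y) (h3 : InvP q u z) : False := by
  have a1 := h.cls h1
  have a2 := h.cls h2
  have a3 := h.cls h3
  have b1 := h.m1 u x y hxy
  have b2 := h.m1 u x z hxz
  have b3 := h.m1 u y z hyz
  have c1 := h.m2 u x y hxy
  have c2 := h.m2 u x z hxz
  have c3 := h.m2 u y z hyz
  rcases a1 with a1 | a1 <;> rcases a2 with a2 | a2 <;> rcases a3 with a3 | a3 <;>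
    first
      | exact b1 a1 a2
      | exact b2 a1 a3
      | exact b3 a2 a3
      | exact c1 a1 a2
      | exact c2 a1 a3
      | exact c3 a2 a3

theorem tri (h : MPair n R p q) {x y z : ℕ}
    (h1 : InvP q x y) (h2 : InvP q y z) (h3 : InvP q x z) : False := by
  have hne : x ≠ y ∧ y ≠ z ∧ x ≠ z := by
    unfold InvP at *
    omega
  obtain ⟨hxy, hyz, hxz⟩ := hne
  have a1 := h.cls h1
  have a2 := h.cls h2
  have a3 := h.cls h3
  rcases a1 with a1 | a1 <;> rcases a2 with a2 | a2 <;> rcases a3 with a3 | a3 <;>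
    first
      | exact h.m1 x y z hyz a1 a3
      | exact h.m1 y x z hxz a1.symm a2
      | exact h.m1 z x y hxy a3.symm a2.symm
      | exact h.m2 x y z hyz a1 a3
      | exact h.m2 y x z hxz a1.symm a2
      | exact h.m2 z x y hxy a3.symm a2.symm

/-- A non-inverted pair one of whose ends lies in an inverted pair is a forward edge. -/
theorem nonback (h : MPair n R p q) {x y z : ℕ} (hx : x < n) (hy : y < n)
    (hxy : x < y) (hq : q x < q y)
    (hz : InvP q x z ∨ InvP q y z) : R x y := by
  rcases h.tot x y hx hy (by omega) with h0 | h0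
  · exact h0
  · exfalso
    rcases hz with hz | hz
    · have hne : y ≠ z := by
        rintro rfl
        unfold InvP at hz
        omega
      rcases h.cls hz with h1 | h1
      · exact h.m1 x y z hne (Or.inl ⟨hxy, h0⟩) h1
      · exact h.m2 x y z hne (Or.inl ⟨hq, h0⟩) h1
    · have hne : x ≠ z := by
        rintro rfl
        unfold InvP at hz
        omega
      rcases h.cls hz with h1 | h1
      · exact h.m1 y x z hne (Or.inr ⟨hxy, h0⟩) h1
      · exact h.m2 y x z hne (Or.inr ⟨hq, h0⟩) h1

/-- Two inverted pairs sharing a vertex which is the middle of a path. -/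
theorem alt (h : MPair n R p q) {x y z : ℕ} (hxz : x < z) (hq : q x < q z)
    (h1 : InvP q x y) (h2 : InvP q y z) : R x y ↔ R y z := by
  have t1 : R x y ∨ R y x := by
    rcases h.cls h1 with (⟨_, h3⟩ | ⟨_, h3⟩) | (⟨_, h3⟩ | ⟨_, h3⟩)
    · exact Or.inr h3
    · exact Or.inl h3
    · exact Or.inr h3
    · exact Or.inl h3
  have t2 : R y z ∨ R z y := by
    rcases h.cls h2 with (⟨_, h3⟩ | ⟨_, h3⟩) | (⟨_, h3⟩ | ⟨_, h3⟩)
    · exact Or.inr h3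
    · exact Or.inl h3
    · exact Or.inr h3
    · exact Or.inl h3
  have b := h.m1 y x z (by omega)
  have c := h.m2 y x z (by omega)
  unfold InvP at h1 h2
  by_cases hxy : x < y
  · have o1 : q y < q x := by omega
    have o2 : z < y := by omega
    have o3 : q y < q z := by omega
    have b' : R y x → R y z → False := fun r1 r2 => b (Or.inr ⟨hxy, r1⟩) (Or.inr ⟨o2, r2⟩)
    have c' : R x y → R z y → False := fun r1 r2 => c (Or.inl ⟨o1, r1⟩) (Or.inl ⟨o3, r2⟩)
    clear b c h1 h2
    tauto
  · have o0 : y < x := by omega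
    have o1 : q x < q y := by omega
    have o2 : y < z := by omega
    have o3 : q z < q y := by omega
    have b' : R x y → R z y → False := fun r1 r2 => b (Or.inl ⟨o0, r1⟩) (Or.inl ⟨o2, r2⟩)
    have c' : R y x → R y z → False := fun r1 r2 => c (Or.inr ⟨o1, r1⟩) (Or.inr ⟨o3, r2⟩)
    clear b c h1 h2
    tauto

/-- A path of inverted pairs induces a transitive tournament or some `P_m`. -/
theorem path (h : MPair n R p q) {b a : ℕ} (P : ℕ → ℕ)
    (hn : ∀ k, b ≤ k → k ≤ a → P k < n)
    (hf : ∀ k l, b ≤ k → k + 2 ≤ l → l ≤ a → P k < P l ∧ q (P k) < q (P l))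
    (hi : ∀ k, b ≤ k → k + 1 ≤ a → InvP q (P k) (P (k + 1))) :
    (∀ x y, b ≤ x → x < y → y ≤ a → R (P x) (P y)) ∨
    (∀ x y, b ≤ x → x ≤ a → b ≤ y → y ≤ a → (R (P x) (P y) ↔ (x + 2 ≤ y ∨ x = y + 1))) := by
  have hfar : ∀ k l, b ≤ k → k + 2 ≤ l → l ≤ a → R (P k) (P l) := by
    intro k l h1 h2 h3
    obtain ⟨h4, h5⟩ := hf k l h1 h2 h3
    exact h.nonback (hn k h1 (by omega)) (hn l (by omega) h3) h4 h5
      (Or.inl (hi k h1 (by omega)))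
  have hstep : ∀ d, b + d + 1 ≤ a →
      (R (P b) (P (b + 1)) ↔ R (P (b + d)) (P (b + d + 1))) := by
    intro d
    induction d with
    | zero => intro _; rfl
    | succ d ih =>
      intro hd
      rw [ih (by omega)]
      obtain ⟨h4, h5⟩ := hf (b + d) (b + d + 2) (by omega) (by omega) (by omega)
      exact h.alt h4 h5 (hi (b + d) (by omega) (by omega)) (hi (b + d + 1) (by omega) (by omega))
  have hirr : ∀ x, ¬ R x x := fun x hx => h.asy x x hx hx
  by_cases hA : R (P b) (P (b + 1))
  · left
    intro x y h1 h2 h3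
    by_cases hy : y = x + 1
    · subst hy
      have := (hstep (x - b) (by omega)).1 hA
      rwa [show b + (x - b) = x by omega] at this
    · exact hfar x y h1 (by omega) h3
  · right
    have hback : ∀ x, b ≤ x → x + 1 ≤ a → R (P (x + 1)) (P x) := by
      intro x h1 h2
      have h3 := mt (hstep (x - b) (by omega)).2 hA
      rw [show b + (x - b) = x by omega] at h3
      have h4 := hi x h1 h2
      have hne : P x ≠ P (x + 1) := by
        unfold InvP at h4
        omega
      exact (h.tot _ _ (hn x h1 (by omega)) (hn (x + 1) (by omega) h2) hne).resolve_left h3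
    intro x y h1 h2 h3 h4
    rcases Nat.lt_trichotomy x y with hxy | hxy | hxy
    · by_cases hy : y = x + 1
      · subst hy
        have := h.asy _ _ (hback x h1 h4)
        constructor
        · intro hc; exact absurd hc this
        · intro hc; omega
      · have := hfar x y h1 (by omega) h4
        constructor
        · intro _; omega
        · intro _; exact this
    · subst hxy
      constructor
      · intro hc; exact absurd hc (hirr _)
      · intro hc; omega
    · by_cases hy : x = y + 1
      · subst hy
        have := hback y h3 h2
        constructor
        · intro _; omega
        · intro _; exact this
      · have := h.asy _ _ (hfar y x h3 (by omega) h2)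
        constructor
        · intro hc; exact absurd hc this
        · intro hc; omega

/-- Shape of the permutation on a block. -/
def Shape (p : ℕ → ℕ) (b a : ℕ) : Prop :=
  (∀ x, b ≤ x → x ≤ a → p x = pi2N b a (pi1N b a x)) ∨
  (∀ x, b ≤ x → x ≤ a → p x = pi1N b a (pi2N b a x)) ∨
  (a = b + 3 ∧ ∀ x, b ≤ x → x ≤ a → p x = tauX b x)

set_option maxHeartbeats 4000000 in
theorem state (h : MPair n R p q) {b : ℕ} (hb : ∀ y, b ≤ y ↔ b ≤ q y) :
    ∀ d s, n - s ≤ d → b + 1 ≤ s → s ≤ n →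
    (∀ x, b ≤ x → x < s → p x = if x % 2 = s % 2 then x + 2 else if b + 2 ≤ x then x - 2
      else if x = b then b + 1 else b) →
    (∀ y, b ≤ y → y ≤ s → y + 1 ≠ s → q y < s) → (∀ y, q y < s → y ≤ s ∧ y + 1 ≠ s) →
    ∃ a, b ≤ a ∧ a < n ∧ Shape p b a := by
  intro d
  induction d with
  | zero =>
    intro s h1 h2 h3 _ h5 h6
    exfalso
    have h7 := h.out s (by omega)
    have := h5 s (by omega) le_rfl (by omega)
    omega
  | succ d ih =>
    intro s hd hs hsn hp hu hu'
    have hsn' : s < n := by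
      by_contra hc
      have h7 := h.out s (by omega)
      have := hu s (by omega) le_rfl (by omega)
      omega
    obtain ⟨m, rfl⟩ : ∃ m, s = m + 1 := ⟨s - 1, by omega⟩
    have hqs : q (p (m + 1)) = m + 1 := h.qp _
    have hqn : ∀ x y, p x ≠ y → q y ≠ x := by
      rintro x y hxy rfl
      exact hxy (h.pq y)
    have hqm : ¬ q m < m + 1 := fun hc => by
      have := hu' m hc
      omega
    have hbp : ∀ x, b ≤ x → b ≤ p x := fun x hx => (hb (p x)).2 (by rwa [h.qp])
    have hbp1 := hbp (m + 1) (by omega)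
    have hv1 : p (m + 1) = m ∨ m + 2 ≤ p (m + 1) := by
      by_contra hc
      have := hu (p (m + 1)) (by omega) (by omega) (by omega)
      omega
    have hq2 : ∀ y, m + 2 ≤ y → m + 1 ≤ q y := by
      intro y hy
      by_contra hc
      have := hu' y (by omega)
      omega
    have hqs' := hu (m + 1) (by omega) le_rfl (by omega)
    rcases hv1 with hv1 | hv1
    · refine ⟨m + 1, by omega, hsn', ?_⟩
      by_cases hpar : (m + 1 - b) % 2 = 0
      · left
        intro x hx1 hx2
        by_cases hx : x = m + 1
        · subst hx
          rw [hv1]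
          unfold pi1N pi2N
          split_ifs <;> omega
        · rw [hp x hx1 (by omega)]
          unfold pi1N pi2N
          split_ifs <;> omega
      · right; left
        intro x hx1 hx2
        by_cases hx : x = m + 1
        · subst hx
          rw [hv1]
          unfold pi1N pi2N
          split_ifs <;> omega
        · rw [hp x hx1 (by omega)]
          unfold pi1N pi2N
          split_ifs <;> omega
    · have hq2' : ∀ y, m + 2 ≤ y → y ≠ p (m + 1) → m + 2 ≤ q y := by
        intro y hy hne
        have h1 := hq2 y hy
        have h2 := hqn (m + 1) y (Ne.symm hne)
        omega
      have hqm2 : m + 2 ≤ q m := by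
        have h2 := hqn (m + 1) m (by omega)
        omega
      have hv2 : p (m + 1) ≤ m + 3 := by
        by_contra hc
        have e1 := hq2' (m + 2) (by omega) (by omega)
        have e2 := hq2' (m + 3) (by omega) (by omega)
        refine h.d3 (u := p (m + 1)) (x := m) (y := m + 2) (z := m + 3)
          (by omega) (by omega) (by omega) ?_ ?_ ?_ <;> unfold InvP <;> omega
      have hw : p (m + 2) = m := by
        by_contra hc
        have hbp2 := hbp (m + 2) (by omega)
        have hqw : q (p (m + 2)) = m + 2 := h.qp _
        have hne : p (m + 2) ≠ p (m + 1) := by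
          intro hc
          rw [hc] at hqw
          omega
        have hw1 : m + 2 ≤ p (m + 2) := by
          by_contra hc
          have := hu (p (m + 2)) (by omega) (by omega) (by omega)
          omega
        have hne2 : q m ≠ m + 2 := hqn _ _ hc
        refine h.d3 (u := m) (x := m + 1) (y := p (m + 1)) (z := p (m + 2))
          (by omega) (by omega) (by omega) ?_ ?_ ?_ <;> unfold InvP <;> omega
      have hqm3 : q m = m + 2 := by
        have := h.qp (m + 2)
        rwa [hw] at this
      have hm2n : m + 2 < n := by
        have := h.qlt (x := m) (by omega)
        omega
      by_cases hv3 : p (m + 1) = m + 2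
      · refine ⟨m + 2, by omega, hm2n, ?_⟩
        by_cases hpar : (m + 1 - b) % 2 = 0
        · left
          intro x hx1 hx2
          by_cases hx : x = m + 1
          · subst hx
            rw [hv3]
            unfold pi1N pi2N
            split_ifs <;> omega
          by_cases hx' : x = m + 2
          · subst hx'
            rw [hw]
            unfold pi1N pi2N
            split_ifs <;> omega
          · rw [hp x hx1 (by omega)]
            unfold pi1N pi2N
            split_ifs <;> omega
        · right; left
          intro x hx1 hx2
          by_cases hx : x = m + 1
          · subst hx
            rw [hv3]
            unfold pi1N pi2N
            split_ifs <;> omega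
          by_cases hx' : x = m + 2
          · subst hx'
            rw [hw]
            unfold pi1N pi2N
            split_ifs <;> omega
          · rw [hp x hx1 (by omega)]
            unfold pi1N pi2N
            split_ifs <;> omega
      · have hv4 : p (m + 1) = m + 3 := by omega
        rw [hv4] at hqs
        refine ih (m + 3) (by omega) (by omega) (by omega) ?_ ?_ ?_
        · intro x hx1 hx2
          by_cases hx : x = m + 1
          · subst hx
            rw [hv4]
            split_ifs <;> omega
          by_cases hx' : x = m + 2
          · subst hx'
            rw [hw]
            split_ifs <;> omega
          · rw [hp x hx1 (by omega)]
            split_ifs <;> omega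
        · intro y hy1 hy2 hy3
          by_cases hy4 : y = m
          · subst hy4; omega
          by_cases hy5 : y = m + 3
          · subst hy5; omega
          · have := hu y hy1 (by omega) (by omega)
            omega
        · intro y hy
          by_cases hy1 : q y < m + 1
          · have := hu' y hy1
            omega
          · by_cases hy2 : q y = m + 1
            · have : y = m + 3 := h.qinj (by omega)
              omega
            · have : y = m := h.qinj (by omega)
              omega

theorem core (h : MPair n R p q) {b : ℕ} (hbn : b < n) (hb : ∀ y, b ≤ y ↔ b ≤ q y) :
    ∃ a, b ≤ a ∧ a < n ∧ Shape p b a := by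
  have hqn : ∀ x y, p x ≠ y → q y ≠ x := by
    rintro x y hxy rfl
    exact hxy (h.pq y)
  have hbp : ∀ x, b ≤ x → b ≤ p x := fun x hx => (hb (p x)).2 (by rwa [h.qp])
  have h0 := hbp b le_rfl
  have hq0 : q (p b) = b := h.qp b
  have hge : ∀ y, b ≤ y → y ≠ p b → b + 1 ≤ q y := by
    intro y hy hne
    have := (hb y).1 hy
    have := hqn b y (Ne.symm hne)
    omega
  have hle : p b ≤ b + 2 := by
    by_contra hc
    have e0 := hge b (by omega) (by omega)
    have e1 := hge (b + 1) (by omega) (by omega)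
    have e2 := hge (b + 2) (by omega) (by omega)
    refine h.d3 (u := p b) (x := b) (y := b + 1) (z := b + 2)
          (by omega) (by omega) (by omega) ?_ ?_ ?_ <;> unfold InvP <;> omega
  obtain h1 | h1 | h1 : p b = b ∨ p b = b + 1 ∨ p b = b + 2 := by omega
  · refine ⟨b, le_rfl, hbn, Or.inl ?_⟩
    intro x hx1 hx2
    have : x = b := by omega
    subst this
    rw [h1]
    unfold pi1N pi2N
    split_ifs <;> omega
  · refine h.state (b := b) hb (n - (b + 1)) (b + 1) le_rfl le_rfl hbn ?_ ?_ ?_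
    · intro x hx1 hx2
      have : x = b := by omega
      subst this
      rw [h1]
      split_ifs <;> omega
    · intro y hy1 hy2 hy3
      have : y = p b := by omega
      rw [this]
      omega
    · intro y hy
      have hy1 : y < b ∨ y = b + 1 := by
        by_contra hc
        have := hge y (by omega) (by omega)
        omega
      omega
  · rw [h1] at hq0
    have e0 := hge b (by omega) (by omega)
    have e1 := hge (b + 1) (by omega) (by omega)
    have hplt := h.plt hbn
    have hge1 : ∀ y, b ≤ y → y ≠ b + 2 → y ≠ p (b + 1) → b + 2 ≤ q y := by
      intro y hy hne hne2
      have := hge y hy (by omega)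
      have := hqn (b + 1) y (Ne.symm hne2)
      omega
    have hq1 : q (p (b + 1)) = b + 1 := h.qp _
    have g1 := hbp (b + 1) (by omega)
    have g2 : p (b + 1) ≠ b + 2 := by
      intro hc
      rw [hc] at hq1
      omega
    have g3 : p (b + 1) ≠ b + 1 := by
      intro hc
      have := hge1 b (by omega) (by omega) (by omega)
      rw [hc] at hq1
      refine h.tri (x := b) (y := b + 1) (z := b + 2) ?_ ?_ ?_ <;> unfold InvP <;> omega
    have g4 : p (b + 1) ≤ b + 3 := by
      by_contra hc
      have e0 := hge1 b (by omega) (by omega) (by omega)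
      have e1 := hge1 (b + 1) (by omega) (by omega) (by omega)
      have e2 := hge1 (b + 3) (by omega) (by omega) (by omega)
      refine h.d3 (u := p (b + 1)) (x := b) (y := b + 1) (z := b + 3)
          (by omega) (by omega) (by omega) ?_ ?_ ?_ <;> unfold InvP <;> omega
    obtain h2 | h2 : p (b + 1) = b ∨ p (b + 1) = b + 3 := by omega
    · refine h.state (b := b) hb (n - (b + 2)) (b + 2) le_rfl (by omega)
        (by omega) ?_ ?_ ?_
      · intro x hx1 hx2
        obtain hx | hx : x = b ∨ x = b + 1 := by omega
        · subst hx
          rw [h1]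
          split_ifs <;> omega
        · subst hx
          rw [h2]
          split_ifs <;> omega
      · intro y hy1 hy2 hy3
        obtain hy | hy : y = b ∨ y = b + 2 := by omega
        · rw [h2] at hq1
          subst hy; omega
        · subst hy; omega
      · intro y hy
        by_contra hc
        by_cases hyb : y < b
        · omega
        · have := hge1 y (by omega) (by omega) (by omega)
          omega
    · rw [h2] at hq1
      have f0 := hge1 b (by omega) (by omega) (by omega)
      have f1 := hge1 (b + 1) (by omega) (by omega) (by omega)
      have hlt3 : b + 3 < n := by
        have := h.plt (x := b + 1) (by omega)
        omega
      have k2 : p (b + 2) = b := by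
        by_contra hc
        have r0 := hqn _ _ hc
        have r1 := hbp (b + 2) (by omega)
        have r2 : q (p (b + 2)) = b + 2 := h.qp _
        have r3 : p (b + 2) ≠ b + 2 := by
          intro hc
          rw [hc] at r2
          omega
        have r4 : p (b + 2) ≠ b + 3 := by
          intro hc
          rw [hc] at r2
          omega
        refine h.d3 (u := b) (x := b + 2) (y := b + 3) (z := p (b + 2))
          (by omega) (by omega) (by omega) ?_ ?_ ?_ <;> unfold InvP <;> omega
      have s2 : q b = b + 2 := by
        have := h.qp (b + 2)
        rwa [k2] at this
      have k3 : p (b + 3) = b + 1 := by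
        by_contra hc
        have r0 := hqn _ _ hc
        have r1 := hbp (b + 3) (by omega)
        have r2 : q (p (b + 3)) = b + 3 := h.qp _
        have r3 : p (b + 3) ≠ b + 2 := by
          intro hc
          rw [hc] at r2
          omega
        have r4 : p (b + 3) ≠ b + 3 := by
          intro hc
          rw [hc] at r2
          omega
        have r5 : p (b + 3) ≠ b := by
          intro hc
          rw [hc] at r2
          omega
        have r6 : q (b + 1) ≠ b + 2 := hqn _ _ (by omega)
        refine h.d3 (u := b + 1) (x := b + 2) (y := b + 3) (z := p (b + 3))
          (by omega) (by omega) (by omega) ?_ ?_ ?_ <;> unfold InvP <;> omega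
      refine ⟨b + 3, by omega, hlt3, Or.inr (Or.inr ⟨rfl, ?_⟩)⟩
      intro x hx1 hx2
      obtain hx | hx | hx | hx : x = b ∨ x = b + 1 ∨ x = b + 2 ∨ x = b + 3 := by omega
      all_goals
        subst hx
        unfold tauX
        split_ifs <;> omega

end MPair

section PiLemmas

theorem pi1_mem {b a k : ℕ} (h1 : b ≤ k) (h2 : k ≤ a) :
    b ≤ pi1N b a k ∧ pi1N b a k ≤ a := by
  unfold pi1N
  split_ifs <;> omega

theorem pi2_mem {b a k : ℕ} (h1 : b ≤ k) (h2 : k ≤ a) :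
    b ≤ pi2N b a k ∧ pi2N b a k ≤ a := by
  unfold pi2N
  split_ifs <;> omega

theorem pi1_pi1 {b a k : ℕ} : pi1N b a (pi1N b a k) = k := by
  unfold pi1N
  split_ifs <;> omega

theorem pi2_pi2 {b a k : ℕ} : pi2N b a (pi2N b a k) = k := by
  unfold pi2N
  split_ifs <;> omega

theorem pi1_far {b a k l : ℕ} (h1 : b ≤ k) (h2 : k + 2 ≤ l) (h3 : l ≤ a) :
    pi1N b a k < pi1N b a l := by
  unfold pi1N
  split_ifs <;> omega

theorem pi2_far {b a k l : ℕ} (h1 : b ≤ k) (h2 : k + 2 ≤ l) (h3 : l ≤ a) :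
    pi2N b a k < pi2N b a l := by
  unfold pi2N
  split_ifs <;> omega

theorem pi12_inv {b a k : ℕ} (h1 : b ≤ k) (h2 : k + 1 ≤ a) :
    (pi1N b a k < pi1N b a (k + 1) ∧ pi2N b a (k + 1) < pi2N b a k) ∨
    (pi1N b a (k + 1) < pi1N b a k ∧ pi2N b a k < pi2N b a (k + 1)) := by
  unfold pi1N pi2N
  split_ifs <;> omega

theorem sigma_pi {b a k : ℕ} (h1 : b ≤ k) (h2 : k ≤ a) :
    sigmaX b a (pi1N b a k) = pi2N b a k := by
  unfold sigmaX pi1N pi2N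
  split_ifs <;> omega

end PiLemmas

namespace MPair

variable {n : ℕ} {R : ℕ → ℕ → Prop} {p q : ℕ → ℕ}

/-- The relation along `P` is transitive. -/
def RTr (R : ℕ → ℕ → Prop) (b a : ℕ) (P : ℕ → ℕ) : Prop :=
  ∀ x y, b ≤ x → x < y → y ≤ a → R (P x) (P y)

/-- The relation along `P` is that of `P_m`. -/
def RPP (R : ℕ → ℕ → Prop) (b a : ℕ) (P : ℕ → ℕ) : Prop :=
  ∀ x y, b ≤ x → x ≤ a → b ≤ y → y ≤ a → (R (P x) (P y) ↔ (x + 2 ≤ y ∨ x = y + 1))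

/-- Conclusion about a block in terms of positions. -/
def BlockN (n : ℕ) (R : ℕ → ℕ → Prop) (p : ℕ → ℕ) (b a : ℕ) : Prop :=
  (a = b ∨ ∀ x, b ≤ x → x ≤ a → ∀ v, v < n → (v < b → R v x) ∧ (a < v → R x v)) ∧
  (((∀ x, b ≤ x → x ≤ a → p x = sigmaX b a x) ∧
      (RTr R b a (pi2N b a) ∨ RPP R b a (pi2N b a))) ∨
   ((∀ x, b ≤ x → x ≤ a → sigmaX b a (p x) = x) ∧
      (RTr R b a (pi1N b a) ∨ RPP R b a (pi1N b a))) ∨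
   (a = b + 3 ∧ (∀ x, b ≤ x → x ≤ a → p x = tauX b x) ∧
      (RPP R b a (pi2N b a) ∨ RPP R b a (fun x => pi2N b a (pi1N b a x)))))

/-- A block is preserved by the permutation, and every vertex is in an inverted pair. -/
theorem shape_props (h : MPair n R p q) {b a : ℕ} (hs : Shape p b a) :
    (∀ y, b ≤ y → y ≤ a → b ≤ q y ∧ q y ≤ a) ∧ (∀ x, b ≤ x → x ≤ a → b ≤ p x ∧ p x ≤ a) ∧
    (a = b ∨ ∀ x, b ≤ x → x ≤ a → ∃ z, InvP q x z) ∧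
    ((∀ x, b ≤ x → x ≤ a → p x = pi2N b a (pi1N b a x)) →
      ∀ k, b ≤ k → k ≤ a → q (pi2N b a k) = pi1N b a k) ∧
    ((∀ x, b ≤ x → x ≤ a → p x = pi1N b a (pi2N b a x)) →
      ∀ k, b ≤ k → k ≤ a → q (pi1N b a k) = pi2N b a k) := by
  have q1 : (∀ x, b ≤ x → x ≤ a → p x = pi2N b a (pi1N b a x)) →
      ∀ k, b ≤ k → k ≤ a → q (pi2N b a k) = pi1N b a k := by
    intro hp k h1 h2
    have h3 := pi1_mem h1 h2
    have h4 := hp (pi1N b a k) h3.1 h3.2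
    rw [pi1_pi1] at h4
    rw [← h4, h.qp]
  have q2 : (∀ x, b ≤ x → x ≤ a → p x = pi1N b a (pi2N b a x)) →
      ∀ k, b ≤ k → k ≤ a → q (pi1N b a k) = pi2N b a k := by
    intro hp k h1 h2
    have h3 := pi2_mem h1 h2
    have h4 := hp (pi2N b a k) h3.1 h3.2
    rw [pi2_pi2] at h4
    rw [← h4, h.qp]
  rcases hs with hs | hs | ⟨rfl, hs⟩
  · have q3 := q1 hs
    refine ⟨?_, ?_, ?_, q1, q2⟩
    · intro y h1 h2
      have h3 := pi2_mem h1 h2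
      have h4 := q3 _ h3.1 h3.2
      rw [pi2_pi2] at h4
      rw [h4]
      exact pi1_mem h3.1 h3.2
    · intro x h1 h2
      rw [hs x h1 h2]
      have h3 := pi1_mem h1 h2
      exact pi2_mem h3.1 h3.2
    · by_cases hab : a ≤ b
      · by_cases hab' : a = b
        · exact Or.inl hab'
        · right; intro x _ _; omega
      right
      intro x h1 h2
      have h3 := pi2_mem h1 h2
      have h4 : pi2N b a (pi2N b a x) = x := pi2_pi2
      generalize pi2N b a x = k at h3 h4
      subst h4
      by_cases hk : k + 1 ≤ a
      · refine ⟨pi2N b a (k + 1), ?_⟩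
        have := pi12_inv h3.1 hk
        unfold InvP
        rw [q3 k h3.1 h3.2, q3 (k + 1) (by omega) hk]
        omega
      · obtain ⟨m, rfl⟩ : ∃ m, k = m + 1 := ⟨k - 1, by omega⟩
        refine ⟨pi2N b a m, ?_⟩
        have := pi12_inv (b := b) (a := a) (k := m) (by omega) h3.2
        unfold InvP
        rw [q3 m (by omega) (by omega), q3 (m + 1) (by omega) (by omega)]
        omega
  · have q3 := q2 hs
    refine ⟨?_, ?_, ?_, q1, q2⟩
    · intro y h1 h2
      have h3 := pi1_mem h1 h2
      have h4 := q3 _ h3.1 h3.2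
      rw [pi1_pi1] at h4
      rw [h4]
      exact pi2_mem h3.1 h3.2
    · intro x h1 h2
      rw [hs x h1 h2]
      have h3 := pi2_mem h1 h2
      exact pi1_mem h3.1 h3.2
    · by_cases hab : a ≤ b
      · by_cases hab' : a = b
        · exact Or.inl hab'
        · right; intro x _ _; omega
      right
      intro x h1 h2
      have h3 := pi1_mem h1 h2
      have h4 : pi1N b a (pi1N b a x) = x := pi1_pi1
      generalize pi1N b a x = k at h3 h4
      subst h4
      by_cases hk : k + 1 ≤ a
      · refine ⟨pi1N b a (k + 1), ?_⟩
        have := pi12_inv h3.1 hk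
        unfold InvP
        rw [q3 k h3.1 h3.2, q3 (k + 1) (by omega) hk]
        omega
      · obtain ⟨m, rfl⟩ : ∃ m, k = m + 1 := ⟨k - 1, by omega⟩
        refine ⟨pi1N b a m, ?_⟩
        have := pi12_inv (b := b) (a := a) (k := m) (by omega) h3.2
        unfold InvP
        rw [q3 m (by omega) (by omega), q3 (m + 1) (by omega) (by omega)]
        omega
  · have tt : ∀ x, tauX b (tauX b x) = x := by
      intro x
      unfold tauX
      split_ifs <;> omega
    have tm : ∀ x, b ≤ x → x ≤ b + 3 → b ≤ tauX b x ∧ tauX b x ≤ b + 3 := by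
      intro x _ _
      unfold tauX
      split_ifs <;> omega
    have q3 : ∀ y, b ≤ y → y ≤ b + 3 → q y = tauX b y := by
      intro y h1 h2
      have h3 := tm y h1 h2
      have h4 := hs _ h3.1 h3.2
      rw [tt] at h4
      rw [← h.qp (tauX b y), h4]
    refine ⟨?_, ?_, ?_, q1, q2⟩
    · intro y h1 h2
      rw [q3 y h1 h2]
      exact tm y h1 h2
    · intro y h1 h2
      rw [hs y h1 h2]
      exact tm y h1 h2
    · right
      intro x h1 h2
      refine ⟨tauX b x, ?_⟩
      have h3 := tm x h1 h2
      unfold InvP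
      rw [q3 _ h3.1 h3.2, q3 x h1 h2, tt]
      have : tauX b x ≠ x := by
        unfold tauX
        split_ifs <;> omega
      omega

theorem shape_next (h : MPair n R p q) {b a : ℕ} (hab : b ≤ a) (hs : Shape p b a)
    (hb : ∀ y, b ≤ y ↔ b ≤ q y) : ∀ y, a + 1 ≤ y ↔ a + 1 ≤ q y := by
  obtain ⟨s1, s2, -⟩ := h.shape_props hs
  intro y
  have h1 := hb y
  have h2 := s1 y
  have h3 := s2 (q y)
  rw [h.pq] at h3
  omega

theorem four (h : MPair n R p q) {b : ℕ} (P : ℕ → ℕ) (w0 w1 w2 w3 : ℕ)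
    (p0 : P b = w0) (p1 : P (b + 1) = w1) (p2 : P (b + 2) = w2) (p3 : P (b + 3) = w3)
    (r10 : R w1 w0) (r21 : R w2 w1) (r32 : R w3 w2) (r02 : R w0 w2) (r13 : R w1 w3)
    (r03 : R w0 w3) : RPP R b (b + 3) P := by
  have hirr : ∀ x, ¬ R x x := fun x hx => h.asy x x hx hx
  intro x y h1 h2 h3 h4
  obtain hx | hx | hx | hx : x = b ∨ x = b + 1 ∨ x = b + 2 ∨ x = b + 3 := by omega
  all_goals
    obtain hy | hy | hy | hy : y = b ∨ y = b + 1 ∨ y = b + 2 ∨ y = b + 3 := by omega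
  all_goals
    subst hx
    subst hy
    simp only [p0, p1, p2, p3]
    first
      | exact iff_of_true (by assumption) (by omega)
      | exact iff_of_true (by assumption) (Or.inr trivial)
      | exact iff_of_false (h.asy _ _ (by assumption)) (by omega)
      | exact iff_of_false (hirr _) (by omega)

set_option maxHeartbeats 1000000 in
theorem tau_block (h : MPair n R p q) {b : ℕ} (hbn : b + 3 < n)
    (q0 : q b = b + 2) (q1 : q (b + 1) = b + 3) (q2 : q (b + 2) = b) (q3 : q (b + 3) = b + 1) :
    RPP R b (b + 3) (pi2N b (b + 3)) ∨
    RPP R b (b + 3) (fun x => pi2N b (b + 3) (pi1N b (b + 3) x)) := by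
  have i02 : InvP q b (b + 2) := by unfold InvP; omega
  have i03 : InvP q b (b + 3) := by unfold InvP; omega
  have i12 : InvP q (b + 1) (b + 2) := by unfold InvP; omega
  have i13 : InvP q (b + 1) (b + 3) := by unfold InvP; omega
  have e1 := h.alt (x := b) (z := b + 1) (by omega) (by omega) i02 (inv_symm i12)
  have e2 := h.alt (x := b) (z := b + 1) (by omega) (by omega) i03 (inv_symm i13)
  have e3 := h.alt (x := b + 2) (z := b + 3) (by omega) (by omega) (inv_symm i02) i03
  have e4 := h.alt (x := b + 2) (z := b + 3) (by omega) (by omega) (inv_symm i12) i13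
  have n01 : R b (b + 1) := h.nonback (by omega) (by omega) (by omega) (by omega) (Or.inl i02)
  have n23 : R (b + 2) (b + 3) :=
    h.nonback (by omega) (by omega) (by omega) (by omega) (Or.inl (inv_symm i02))
  have a0 : pi1N b (b + 3) b = b + 1 := by unfold pi1N; split_ifs <;> omega
  have a1 : pi1N b (b + 3) (b + 1) = b := by unfold pi1N; split_ifs <;> omega
  have a2 : pi1N b (b + 3) (b + 2) = b + 3 := by unfold pi1N; split_ifs <;> omega
  have a3 : pi1N b (b + 3) (b + 3) = b + 2 := by unfold pi1N; split_ifs <;> omega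
  have c0 : pi2N b (b + 3) b = b := by unfold pi2N; split_ifs <;> omega
  have c1 : pi2N b (b + 3) (b + 1) = b + 2 := by unfold pi2N; split_ifs <;> omega
  have c2 : pi2N b (b + 3) (b + 2) = b + 1 := by unfold pi2N; split_ifs <;> omega
  have c3 : pi2N b (b + 3) (b + 3) = b + 3 := by unfold pi2N; split_ifs <;> omega
  by_cases hr : R b (b + 2)
  · right
    have r21 := e1.1 hr
    have r13 := e4.1 r21
    have r30 : R (b + 3) b := by
      refine (h.tot b (b + 3) (by omega) (by omega) (by omega)).resolve_left ?_
      intro hc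
      exact h.asy _ _ hr (e3.2 hc)
    refine h.four _ (b + 2) b (b + 3) (b + 1) ?_ ?_ ?_ ?_ hr r30 r13 n23 n01 r21
    · simp only [a0, c1]
    · simp only [a1, c0]
    · simp only [a2, c3]
    · simp only [a3, c2]
  · left
    have r20 : R (b + 2) b :=
      (h.tot b (b + 2) (by omega) (by omega) (by omega)).resolve_left hr
    have r03 := e3.1 r20
    have r31 := e2.1 r03
    have r12 : R (b + 1) (b + 2) := by
      refine (h.tot (b + 1) (b + 2) (by omega) (by omega) (by omega)).resolve_right ?_
      intro hc
      exact hr (e1.2 hc)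
    exact h.four _ b (b + 2) (b + 1) (b + 3) c0 c1 c2 c3 r20 r12 r31 n01 n23 r03

theorem block (h : MPair n R p q) {b a : ℕ} (han : a < n) (hs : Shape p b a)
    (hb : ∀ y, b ≤ y ↔ b ≤ q y) : BlockN n R p b a := by
  obtain ⟨s1, s2, s3, s4, s5⟩ := h.shape_props hs
  constructor
  · rcases s3 with s3 | s3
    · exact Or.inl s3
    · right
      intro x h1 h2 v hv
      obtain ⟨z, hz⟩ := s3 x h1 h2
      have hqx := s1 x h1 h2
      constructor
      · intro hvb
        have := hb v
        exact h.nonback hv (by omega) (by omega) (by omega) (Or.inr hz)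
      · intro hav
        have h3 := h.shape_next (by omega) hs hb v
        exact h.nonback (by omega) hv (by omega) (by omega) (Or.inl hz)
  · rcases hs with hs | hs | ⟨rfl, hs⟩
    · left
      have q3 := s4 hs
      constructor
      · intro x h1 h2
        rw [hs x h1 h2]
        have h3 := pi1_mem h1 h2
        have h4 := sigma_pi h3.1 h3.2
        rw [pi1_pi1] at h4
        exact h4.symm
      · refine h.path _ ?_ ?_ ?_
        · intro k h1 h2
          have := pi2_mem h1 h2
          omega
        · intro k l h1 h2 h3
          rw [q3 k h1 (by omega), q3 l (by omega) h3]
          exact ⟨pi2_far h1 h2 h3, pi1_far h1 h2 h3⟩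
        · intro k h1 h2
          unfold InvP
          rw [q3 k h1 (by omega), q3 (k + 1) (by omega) h2]
          have := pi12_inv h1 h2
          omega
    · right; left
      have q3 := s5 hs
      constructor
      · intro x h1 h2
        rw [hs x h1 h2]
        have h3 := pi2_mem h1 h2
        have h4 := sigma_pi h3.1 h3.2
        rw [pi2_pi2] at h4
        exact h4
      · refine h.path _ ?_ ?_ ?_
        · intro k h1 h2
          have := pi1_mem h1 h2
          omega
        · intro k l h1 h2 h3
          rw [q3 k h1 (by omega), q3 l (by omega) h3]
          exact ⟨pi1_far h1 h2 h3, pi2_far h1 h2 h3⟩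
        · intro k h1 h2
          unfold InvP
          rw [q3 k h1 (by omega), q3 (k + 1) (by omega) h2]
          have := pi12_inv h1 h2
          omega
    · right; right
      refine ⟨rfl, hs, ?_⟩
      have g : ∀ x y, p x = y → q y = x := by
        rintro x y rfl
        exact h.qp x
      refine h.tau_block han ?_ ?_ ?_ ?_ <;> refine g _ _ ?_ <;> rw [hs _ (by omega) (by omega)] <;>
        unfold tauX <;> split_ifs <;> omega

end MPair

/-- Conclusion about one block `[b, c)` in terms of the tournament. -/
def BlockT {V : Type} (T : Tournament V) {n : ℕ} (e : Fin n → V) (π : Equiv.Perm (Fin n))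
    (b c : ℕ) : Prop :=
  T.HomogOn Set.univ
          (e '' {x : Fin n | b ≤ x.val ∧ x.val ≤ c - 1}) ∧
        (((∀ x : Fin n, b ≤ x.val → x.val ≤ c - 1 →
              (π x : ℕ) = sigmaX b (c - 1) x.val) ∧
            (SegTrans T e b (c - 1) (pi2N b (c - 1)) ∨
              SegP T e b (c - 1) (pi2N b (c - 1)))) ∨
          ((∀ x : Fin n, b ≤ x.val → x.val ≤ c - 1 →
              sigmaX b (c - 1) (π x : ℕ) = x.val) ∧
            (SegTrans T e b (c - 1) (pi1N b (c - 1)) ∨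
              SegP T e b (c - 1) (pi1N b (c - 1)))) ∨
          (c = b + 4 ∧
            (∀ x : Fin n, b ≤ x.val → x.val ≤ c - 1 →
              (π x : ℕ) = tauX b x.val) ∧
            (SegP T e b (c - 1) (pi2N b (c - 1)) ∨
              SegP T e b (c - 1)
                (fun x => pi1N b (c - 1) (pi2N b (c - 1) x)))))

/-- The tournament relation on positions. -/
def posRel {V : Type} (T : Tournament V) {n : ℕ} (e : Fin n → V) (i j : ℕ) : Prop :=
  ∃ (hi : i < n) (hj : j < n), T.rel (e ⟨i, hi⟩) (e ⟨j, hj⟩)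

/-- A permutation of `Fin n` as a function on the natural numbers. -/
def posPerm {n : ℕ} (π : Equiv.Perm (Fin n)) (x : ℕ) : ℕ :=
  if h : x < n then (π ⟨x, h⟩).val else x

theorem posPerm_fin {n : ℕ} (π : Equiv.Perm (Fin n)) (x : Fin n) :
    posPerm π x.val = (π x).val := by
  simp [posPerm]

theorem posPerm_out {n : ℕ} (π : Equiv.Perm (Fin n)) (x : ℕ) (hx : n ≤ x) :
    posPerm π x = x := by
  simp [posPerm, Nat.not_lt.2 hx]

theorem posRel_fin {V : Type} (T : Tournament V) {n : ℕ} (e : Fin n → V) (i j : Fin n) :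
    posRel T e i.val j.val ↔ T.rel (e i) (e j) := by
  constructor
  · rintro ⟨_, _, h⟩; exact h
  · intro h; exact ⟨i.2, j.2, h⟩

theorem posPerm_inv {n : ℕ} (π ρ : Equiv.Perm (Fin n)) (h : ∀ x, π (ρ x) = x) (x : ℕ) :
    posPerm π (posPerm ρ x) = x := by
  by_cases hx : x < n
  · have h1 := posPerm_fin ρ ⟨x, hx⟩
    have h2 := posPerm_fin π (ρ ⟨x, hx⟩)
    rw [← h1, h] at h2
    exact h2
  · rw [posPerm_out ρ x (by omega), posPerm_out π x (by omega)]

theorem mpair_of {V : Type} (T : Tournament V) {n : ℕ}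
    (e : Fin n → V) (he : MatchingOrd T.rel e)
    (π : Equiv.Perm (Fin n)) (hπ : MatchingOrd T.rel (e ∘ π)) :
    MPair n (posRel T e) (posPerm π) (posPerm π.symm) where
  pq := posPerm_inv _ _ (by simp)
  qp := posPerm_inv _ _ (by simp)
  out := posPerm_out _
  asy := by
    rintro x y ⟨hx, hy, h1⟩ ⟨_, _, h2⟩
    exact T.asymm _ _ h1 h2
  tot := by
    intro x y hx hy hne
    have : e ⟨x, hx⟩ ≠ e ⟨y, hy⟩ := by
      intro hc
      have := he.1.1 hc
      simp at this
      exact hne this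
    rcases T.total _ _ this with h | h
    · exact Or.inl ⟨hx, hy, h⟩
    · exact Or.inr ⟨hy, hx, h⟩
  m1 := by
    intro x y z hne h1 h2
    have hx : x < n := by rcases h1 with ⟨_, h, h', _⟩ | ⟨_, h, h', _⟩ <;> assumption
    have hy : y < n := by rcases h1 with ⟨_, h, h', _⟩ | ⟨_, h, h', _⟩ <;> assumption
    have hz : z < n := by rcases h2 with ⟨_, h, h', _⟩ | ⟨_, h, h', _⟩ <;> assumption
    have key := he.2 ⟨x, hx⟩ (x := ⟨y, hy⟩) (y := ⟨z, hz⟩)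
    have := key (by
      rcases h1 with ⟨h0, h, h', h''⟩ | ⟨h0, h, h', h''⟩
      · exact Or.inl ⟨h0, h''⟩
      · exact Or.inr ⟨h0, h''⟩) (by
      rcases h2 with ⟨h0, h, h', h''⟩ | ⟨h0, h, h', h''⟩
      · exact Or.inl ⟨h0, h''⟩
      · exact Or.inr ⟨h0, h''⟩)
    simp at this
    exact hne this
  m2 := by
    intro x y z hne h1 h2
    have hx : x < n := by rcases h1 with ⟨_, h, h', _⟩ | ⟨_, h, h', _⟩ <;> assumption
    have hy : y < n := by rcases h1 with ⟨_, h, h', _⟩ | ⟨_, h, h', _⟩ <;> assumption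
    have hz : z < n := by rcases h2 with ⟨_, h, h', _⟩ | ⟨_, h, h', _⟩ <;> assumption
    have ex := posPerm_fin π.symm ⟨x, hx⟩
    have ey := posPerm_fin π.symm ⟨y, hy⟩
    have ez := posPerm_fin π.symm ⟨z, hz⟩
    simp only at ex ey ez
    rw [ex, ey] at h1
    rw [ex, ez] at h2
    have key := hπ.2 (π.symm ⟨x, hx⟩) (x := π.symm ⟨y, hy⟩) (y := π.symm ⟨z, hz⟩)
    have := key (by
      simp only [Function.comp, Set.mem_ofPred_eq, Equiv.apply_symm_apply]
      rcases h1 with ⟨h0, h, h', h''⟩ | ⟨h0, h, h', h''⟩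
      · exact Or.inl ⟨h0, h''⟩
      · exact Or.inr ⟨h0, h''⟩) (by
      simp only [Function.comp, Set.mem_ofPred_eq, Equiv.apply_symm_apply]
      rcases h2 with ⟨h0, h, h', h''⟩ | ⟨h0, h, h', h''⟩
      · exact Or.inl ⟨h0, h''⟩
      · exact Or.inr ⟨h0, h''⟩)
    have h3 := π.symm.injective this
    simp at h3
    exact hne h3

/-- Extension of the ordering to a function on the natural numbers. -/
noncomputable def extE {V : Type} {n : ℕ} (e : Fin n → V) (hn : 0 < n) (x : ℕ) : V :=
  if h : x < n then e ⟨x, h⟩ else e ⟨0, hn⟩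

theorem extE_fin {V : Type} {n : ℕ} (e : Fin n → V) (hn : 0 < n) (x : Fin n) :
    extE e hn x.val = e x := by
  simp [extE]

theorem extE_rel {V : Type} (T : Tournament V) {n : ℕ} (e : Fin n → V) (hn : 0 < n) {x y : ℕ}
    (hx : x < n) (hy : y < n) : T.rel (extE e hn x) (extE e hn y) ↔ posRel T e x y := by
  have h1 := extE_fin e hn ⟨x, hx⟩
  have h2 := extE_fin e hn ⟨y, hy⟩
  simp only at h1 h2
  rw [h1, h2]
  exact (posRel_fin T e ⟨x, hx⟩ ⟨y, hy⟩).symm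

theorem segTrans_of {V : Type} (T : Tournament V) {n : ℕ} (e : Fin n → V) {b a : ℕ}
    (han : a < n) (P P' : ℕ → ℕ) (hPP : ∀ x, P (P' x) = x)
    (hP : ∀ k, b ≤ k → k ≤ a → P k ≤ a)
    (hr : MPair.RTr (posRel T e) b a P) : SegTrans T e b a P' := by
  refine ⟨fun k => extE e (by omega) (P k), ?_, ?_⟩
  · intro x y h1 h2 h3
    have i1 := hP x h1 (by omega)
    have i2 := hP y (by omega) h3
    exact (extE_rel T e _ (by omega) (by omega)).2 (hr x y h1 h2 h3)
  · intro i _ _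
    simp only [hPP, extE_fin]

theorem segP_of {V : Type} (T : Tournament V) {n : ℕ} (e : Fin n → V) {b a : ℕ}
    (han : a < n) (P P' : ℕ → ℕ) (hPP : ∀ x, P (P' x) = x)
    (hP : ∀ k, b ≤ k → k ≤ a → P k ≤ a)
    (hr : MPair.RPP (posRel T e) b a P) : SegP T e b a P' := by
  refine ⟨fun k => extE e (by omega) (P k), ?_, ?_⟩
  · intro x y h1 h2 h3 h4
    have i1 := hP x h1 (by omega)
    have i2 := hP y (by omega) (by omega)
    rw [extE_rel T e _ (by omega) (by omega)]
    exact hr x y h1 h2 h3 h4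
  · intro i _ _
    simp only [hPP, extE_fin]

theorem blockT_of {V : Type} (T : Tournament V) {n : ℕ} (e : Fin n → V)
    (he : Function.Bijective e) (π : Equiv.Perm (Fin n)) {b a : ℕ} (han : a < n)
    (hB : MPair.BlockN n (posRel T e) (posPerm π) b a) : BlockT T e π b (a + 1) := by
  obtain ⟨h1, h2⟩ := hB
  have p1 : ∀ k, b ≤ k → k ≤ a → pi1N b a k ≤ a := fun k i j => (pi1_mem i j).2
  have p2 : ∀ k, b ≤ k → k ≤ a → pi2N b a k ≤ a := fun k i j => (pi2_mem i j).2
  unfold BlockT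
  rw [Nat.add_sub_cancel]
  constructor
  · refine ⟨Set.subset_univ _, ?_⟩
    rintro v ⟨-, hv⟩
    obtain ⟨w, rfl⟩ := he.2 v
    have hw : ¬ (b ≤ w.val ∧ w.val ≤ a) := fun hc => hv ⟨w, hc, rfl⟩
    rcases h1 with rfl | h1
    · have hwa : w ≠ ⟨a, han⟩ := by
        rintro rfl
        simp at hw
      have hx : ∀ x ∈ e '' {x : Fin n | a ≤ x.val ∧ x.val ≤ a}, x = e ⟨a, han⟩ := by
        rintro _ ⟨x, hx, rfl⟩
        congr 1
        ext
        simp only [Set.mem_ofPred_eq] at hx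
        simp only
        omega
      rcases T.total (e w) (e ⟨a, han⟩) (fun hc => hwa (he.1 hc)) with h | h
      · left
        intro x hx'
        rw [hx x hx']
        exact h
      · right
        intro x hx'
        rw [hx x hx']
        exact h
    · by_cases hwb : w.val < b
      · left
        rintro _ ⟨x, hx, rfl⟩
        exact (posRel_fin T e w x).1 ((h1 x hx.1 hx.2 w w.2).1 hwb)
      · right
        rintro _ ⟨x, hx, rfl⟩
        exact (posRel_fin T e x w).1 ((h1 x hx.1 hx.2 w w.2).2 (by omega))
  · rcases h2 with ⟨h3, h4⟩ | ⟨h3, h4⟩ | ⟨rfl, h3, h4⟩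
    · left
      refine ⟨fun x i j => by rw [← posPerm_fin]; exact h3 x i j, ?_⟩
      exact h4.imp (segTrans_of T e han _ _ (fun x => pi2_pi2) p2)
        (segP_of T e han _ _ (fun x => pi2_pi2) p2)
    · right; left
      refine ⟨fun x i j => by rw [← posPerm_fin]; exact h3 x i j, ?_⟩
      exact h4.imp (segTrans_of T e han _ _ (fun x => pi1_pi1) p1)
        (segP_of T e han _ _ (fun x => pi1_pi1) p1)
    · right; right
      refine ⟨rfl, fun x i j => by rw [← posPerm_fin]; exact h3 x i j, ?_⟩
      refine h4.imp (segP_of T e han _ _ (fun x => pi2_pi2) p2)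
        (segP_of T e han _ _ (fun x => ?_) ?_)
      · rw [pi1_pi1, pi2_pi2]
      · intro k i j
        have := pi1_mem i j
        exact (pi2_mem this.1 this.2).2

theorem blocks_exist {V : Type} (T : Tournament V) {n : ℕ}
    (e : Fin n → V) (he : MatchingOrd T.rel e)
    (π : Equiv.Perm (Fin n)) (hπ : MatchingOrd T.rel (e ∘ π)) :
    ∀ d b, n - b ≤ d → b ≤ n → (∀ y, b ≤ y ↔ b ≤ posPerm π.symm y) →
    ∃ r : ℕ, ∃ c : Fin (r + 1) → ℕ, c 0 = b ∧ c (Fin.last r) = n ∧ StrictMono c ∧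
      ∀ i : Fin r, BlockT T e π (c i.castSucc) (c i.succ) := by
  have h := mpair_of T e he π hπ
  intro d
  induction d with
  | zero =>
    intro b h1 h2 _
    refine ⟨0, fun _ => b, rfl, show b = n by omega, ?_, fun i => i.elim0⟩
    intro i j hij
    omega
  | succ d ih =>
    intro b h1 h2 h3
    by_cases hbn : b = n
    · refine ⟨0, fun _ => b, rfl, hbn, ?_, fun i => i.elim0⟩
      intro i j hij
      omega
    · obtain ⟨a, hab, han, hs⟩ := h.core (by omega) h3
      obtain ⟨r, c, c0, cl, cm, cB⟩ := ih (a + 1) (by omega) (by omega) (h.shape_next hab hs h3)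
      have hB := blockT_of T e he.1 π han (h.block han hs h3)
      refine ⟨r + 1, Fin.cons b c, rfl, ?_, ?_, ?_⟩
      · rw [← Fin.succ_last, Fin.cons_succ]
        exact cl
      · rw [Fin.strictMono_iff_lt_succ]
        intro i
        refine Fin.cases ?_ (fun j => ?_) i
        · simp only [Fin.castSucc_zero, Fin.cons_zero, Fin.cons_succ, c0]
          omega
        · rw [← Fin.succ_castSucc, Fin.cons_succ, Fin.cons_succ]
          exact cm (Fin.castSucc_lt_succ)
      · intro i
        refine Fin.cases ?_ (fun j => ?_) i
        · simp only [Fin.castSucc_zero, Fin.cons_zero, Fin.cons_succ, c0]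
          exact hB
        · rw [← Fin.succ_castSucc, Fin.cons_succ, Fin.cons_succ]
          exact cB j

/-- If `e` and `e ∘ π` are both matching orderings of `G`, then the positions
`{0, …, n-1}` can be partitioned into consecutive intervals `X_i = [c_i, c_{i+1})` such
that on each interval `π` acts as `σ_{X_i}`, `σ_{X_i}⁻¹` or `τ_{X_i}`, the corresponding
vertex set `V_i` is a homogeneous set of `G`, the subtournament induced on `V_i` is
transitive or isomorphic to `P_{|V_i|}`, and the induced ordering is `π₂ H_i`, `π₁ H_i`,
or (`τ` case, `|X_i| = 4`, `H_i ≅ P_4`) `π₂ H_i` or `π₂π₁ H_i` respectively. -/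
theorem stmt11 {V : Type} [Fintype V] (T : Tournament V) {n : ℕ}
    (e : Fin n → V) (he : MatchingOrd T.rel e)
    (π : Equiv.Perm (Fin n)) (hπ : MatchingOrd T.rel (e ∘ π)) :
    ∃ r : ℕ, ∃ c : Fin (r + 1) → ℕ, c 0 = 0 ∧ c (Fin.last r) = n ∧ StrictMono c ∧
      ∀ i : Fin r,
        T.HomogOn Set.univ
          (e '' {x : Fin n | c i.castSucc ≤ x.val ∧ x.val ≤ c i.succ - 1}) ∧
        (((∀ x : Fin n, c i.castSucc ≤ x.val → x.val ≤ c i.succ - 1 →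
              (π x : ℕ) = sigmaX (c i.castSucc) (c i.succ - 1) x.val) ∧
            (SegTrans T e (c i.castSucc) (c i.succ - 1)
                (pi2N (c i.castSucc) (c i.succ - 1)) ∨
              SegP T e (c i.castSucc) (c i.succ - 1)
                (pi2N (c i.castSucc) (c i.succ - 1)))) ∨
          ((∀ x : Fin n, c i.castSucc ≤ x.val → x.val ≤ c i.succ - 1 →
              sigmaX (c i.castSucc) (c i.succ - 1) (π x : ℕ) = x.val) ∧
            (SegTrans T e (c i.castSucc) (c i.succ - 1)
                (pi1N (c i.castSucc) (c i.succ - 1)) ∨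
              SegP T e (c i.castSucc) (c i.succ - 1)
                (pi1N (c i.castSucc) (c i.succ - 1)))) ∨
          (c i.succ = c i.castSucc + 4 ∧
            (∀ x : Fin n, c i.castSucc ≤ x.val → x.val ≤ c i.succ - 1 →
              (π x : ℕ) = tauX (c i.castSucc) x.val) ∧
            (SegP T e (c i.castSucc) (c i.succ - 1)
                (pi2N (c i.castSucc) (c i.succ - 1)) ∨
              SegP T e (c i.castSucc) (c i.succ - 1)
                (fun x => pi1N (c i.castSucc) (c i.succ - 1)
                  (pi2N (c i.castSucc) (c i.succ - 1) x))))) := by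
  exact blocks_exist T e he π hπ n 0 (by omega) (Nat.zero_le _) (fun y => by simp)
end

section
/- Every prime tournament which is not isomorphic to P_n for any n has at most one matching ordering. -/
namespace MO

variable {V : Type}

/-- backedge (as an unordered pair) with respect to the position function `p` -/
def Bk (T : Tournament V) (p : V → ℕ) (u v : V) : Prop :=
  (p u < p v ∧ T.rel v u) ∨ (p v < p u ∧ T.rel u v)

/-- inverted pair -/
def Inv (p q : V → ℕ) (u v : V) : Prop :=
  (p u < p v ∧ q v < q u) ∨ (p v < p u ∧ q u < q v)

def Lt (p q : V → ℕ) (u v : V) : Prop := p u < p v ∧ q u < q v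

/-- The standing hypotheses. -/
structure Hyp (T : Tournament V) (p q : V → ℕ) : Prop where
  ip : ∀ u v, p u = p v → u = v
  iq : ∀ u v, q u = q v → u = v
  mp : ∀ u v w, Bk T p u v → Bk T p u w → v = w
  mq : ∀ u v w, Bk T q u v → Bk T q u w → v = w

theorem Inv.symm {p q : V → ℕ} {u v : V} (h : Inv p q u v) : Inv p q v u := by
  unfold Inv at *; tauto

theorem Bk.symm {T : Tournament V} {p : V → ℕ} {u v : V} (h : Bk T p u v) : Bk T p v u := by
  unfold Bk at *; tauto

theorem Inv.ne {p q : V → ℕ} {u v : V} (h : Inv p q u v) : u ≠ v := by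
  rintro rfl; unfold Inv at h; omega

theorem Inv.swap {p q : V → ℕ} {u v : V} (h : Inv p q u v) : Inv q p u v := by
  unfold Inv at *; tauto

theorem Hyp.swap {T : Tournament V} {p q : V → ℕ} (h : Hyp T p q) : Hyp T q p :=
  ⟨h.iq, h.ip, h.mq, h.mp⟩

theorem Inv.cases {T : Tournament V} {p q : V → ℕ} {u v : V} (h : Inv p q u v) :
    (Bk T p u v ∧ ¬ Bk T q u v) ∨ (Bk T q u v ∧ ¬ Bk T p u v) := by
  have h1 := T.total u v h.ne
  have h2 := T.asymm u v
  have h3 := T.asymm v u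
  unfold Inv at h; unfold Bk
  grind

theorem Hyp.tri {T : Tournament V} {p q : V → ℕ} (H : Hyp T p q) (u v : V) (h : u ≠ v) :
    Inv p q u v ∨ Lt p q u v ∨ Lt p q v u := by
  have h1 := H.ip u v
  have h2 := H.iq u v
  unfold Inv Lt
  grind

theorem Hyp.nc {T : Tournament V} {p q : V → ℕ} (H : Hyp T p q) {x y v : V}
    (hi : Inv p q x y) (h1 : Bk T p x v) (h2 : Bk T q x v) : False := by
  rcases Inv.cases (T := T) hi with ⟨h, hh⟩ | ⟨h, hh⟩
  · have := H.mp _ _ _ h h1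
    subst this; exact hh h2
  · have := H.mq _ _ _ h h2
    subst this; exact hh h1

/-- Non-inverted pairs at a vertex with an inversion are oriented by the order. -/
theorem Hyp.rel_of_lt {T : Tournament V} {p q : V → ℕ} (H : Hyp T p q) {x y v : V}
    (hi : Inv p q x y) : (Lt p q x v → T.rel x v) ∧ (Lt p q v x → T.rel v x) := by
  have h0 := fun a b => H.nc (v := v) hi a b
  have h1 := T.total x v
  constructor
  · rintro ⟨a, b⟩
    have : x ≠ v := by rintro rfl; omega
    rcases h1 this with h | h
    · exact h
    · exact (h0 (Or.inl ⟨a, h⟩) (Or.inl ⟨b, h⟩)).elim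
  · rintro ⟨a, b⟩
    have : x ≠ v := by rintro rfl; omega
    rcases h1 this with h | h
    · exact (h0 (Or.inr ⟨a, h⟩) (Or.inr ⟨b, h⟩)).elim
    · exact h

theorem Hyp.reach [Fintype V] {T : Tournament V} {p q : V → ℕ} (H : Hyp T p q)
    (hP : T.PrimeOn Set.univ) {a b : V} (hab : Inv p q a b) (v : V) :
    Relation.ReflTransGen (Inv p q) a v := by
  let X : Set V := {v | Relation.ReflTransGen (Inv p q) a v}
  have hnb : ∀ x ∈ X, ∃ y, Inv p q x y := by
    intro x hx
    rcases Relation.ReflTransGen.cases_tail hx with h | ⟨c, _, h⟩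
    · exact ⟨b, h ▸ hab⟩
    · exact ⟨c, h.symm⟩
  have hX : T.HomogOn Set.univ X := by
    refine ⟨Set.subset_univ _, ?_⟩
    rintro v ⟨-, hv⟩
    have hni : ∀ x ∈ X, ¬ Inv p q x v := fun x hx h => hv (Relation.ReflTransGen.tail hx h)
    have hne : ∀ x ∈ X, x ≠ v := fun x hx h => hv (h ▸ hx)
    have key : (∀ x ∈ X, Lt p q v x) ∨ (∀ x ∈ X, Lt p q x v) := by
      have ha : a ∈ X := Relation.ReflTransGen.refl
      rcases H.tri a v (hne a ha) with h | h | h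
      · exact (hni a ha h).elim
      · right
        intro x hx
        induction hx with
        | refl => exact h
        | @tail c d hc hd ih =>
          have hdX : d ∈ X := Relation.ReflTransGen.tail hc hd
          rcases H.tri d v (hne d hdX) with hh | hh | hh
          · exact (hni d hdX hh).elim
          · exact hh
          · exfalso
            unfold Lt at ih hh; unfold Inv at hd; omega
      · left
        intro x hx
        induction hx with
        | refl => exact h
        | @tail c d hc hd ih =>
          have hdX : d ∈ X := Relation.ReflTransGen.tail hc hd
          rcases H.tri d v (hne d hdX) with hh | hh | hh
          · exact (hni d hdX hh).elim
          · exfalso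
            unfold Lt at ih hh; unfold Inv at hd; omega
          · exact hh
    rcases key with k | k
    · left
      intro x hx
      obtain ⟨y, hy⟩ := hnb x hx
      exact (H.rel_of_lt hy).2 (k x hx)
    · right
      intro x hx
      obtain ⟨y, hy⟩ := hnb x hx
      exact (H.rel_of_lt hy).1 (k x hx)
  rcases hP.2 X hX with h | h
  · exfalso
    have := (Set.ncard_le_one (Set.toFinite X)).1 h a Relation.ReflTransGen.refl b
      (Relation.ReflTransGen.single hab)
    exact hab.ne this
  · have : v ∈ X := by rw [h]; trivial
    exact this

theorem closed_univ {p q : V → ℕ} {a : V} (hr : ∀ v, Relation.ReflTransGen (Inv p q) a v)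
    (S : Set V) (ha : a ∈ S) (hS : ∀ x ∈ S, ∀ y, Inv p q x y → y ∈ S) (v : V) : v ∈ S := by
  have := hr v
  induction this with
  | refl => exact ha
  | tail _ h ih => exact hS _ ih _ h

/-- degree at most two -/
theorem Hyp.deg {T : Tournament V} {p q : V → ℕ} (H : Hyp T p q) {x a b c : V}
    (ha : Inv p q x a) (hb : Inv p q x b) (hab : a ≠ b) (hc : Inv p q x c) : c = a ∨ c = b := by
  have h1 := H.mp x
  have h2 := H.mq x
  have ha := Inv.cases (T := T) ha
  have hb := Inv.cases (T := T) hb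
  have hc := Inv.cases (T := T) hc
  grind

/-- no triangle -/
theorem Hyp.notri {T : Tournament V} {p q : V → ℕ} (H : Hyp T p q) {a b c : V}
    (h1 : Inv p q a b) (h2 : Inv p q b c) (h3 : Inv p q a c) : False := by
  unfold Inv at *
  have e1 := h1
  have := Inv.cases (T := T) h1
  have := Inv.cases (T := T) h2
  have := Inv.cases (T := T) h3
  have n1 := Inv.ne h1
  have n2 := Inv.ne h2
  have n3 := Inv.ne h3
  have hp := H.mp
  have hq := H.mq
  have s := fun u v => @Bk.symm V T p u v
  have s2 := fun u v => @Bk.symm V T q u v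
  grind

/-- the four-cycle configuration is impossible in a prime tournament -/
theorem Hyp.noC4 [Fintype V] {T : Tournament V} {p q : V → ℕ} (H : Hyp T p q)
    (hP : T.PrimeOn Set.univ) {x y z w : V}
    (hxy : Inv p q x y) (hxw : Inv p q x w) (hyz : Inv p q y z)
    (hwz : Inv p q w z) (lxz : Lt p q x z) (lyw : Lt p q y w)
    (hM : Bk T p x y) (hlt : p x < p y) : False := by
  have hwy : w ≠ y := by rintro rfl; unfold Lt at lyw; omega
  have hxz : x ≠ z := by rintro rfl; unfold Lt at lxz; omega
  have hall : ∀ v, v ∈ ({x, y, z, w} : Set V) := by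
    apply closed_univ (H.reach hP hxy)
    · simp
    · intro u hu v huv
      simp only [Set.mem_insert_iff, Set.mem_singleton_iff] at hu ⊢
      rcases hu with rfl | rfl | rfl | rfl
      · rcases H.deg hxy hxw (Ne.symm hwy) huv with h | h <;> simp [h]
      · rcases H.deg hxy.symm hyz hxz huv with h | h <;> simp [h]
      · rcases H.deg hyz.symm hwz.symm (Ne.symm hwy) huv with h | h <;> simp [h]
      · rcases H.deg hxw.symm hwz hxz huv with h | h <;> simp [h]
  have rxz : T.rel x z := (H.rel_of_lt hxy).1 lxz
  have ryw : T.rel y w := (H.rel_of_lt hxy.symm).1 lyw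
  have nyz : ¬ Bk T p y z := fun h => hxz (H.mp _ _ _ hM.symm h)
  have byz : Bk T q y z := by have := Inv.cases (T := T) hyz; grind
  have bwz : Bk T p w z := by
    rcases Inv.cases (T := T) hwz with h | h
    · exact h.1
    · exact absurd (H.mq _ _ _ byz.symm h.1.symm) (Ne.symm hwy)
  have nxw : ¬ Bk T p x w := fun h => hwy (H.mp _ _ _ h hM)
  have tt := T.total w z hwz.ne
  have hhom : T.HomogOn Set.univ {x, w} := by
    refine ⟨Set.subset_univ _, ?_⟩
    rintro v ⟨-, hv⟩
    have := hall v
    simp only [Set.mem_insert_iff, Set.mem_singleton_iff] at this hv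
    have hv2 : v = y ∨ v = z := by tauto
    unfold Inv at *; unfold Bk at hM bwz; unfold Lt at *
    rcases hv2 with rfl | rfl
    · left
      intro t ht
      simp only [Set.mem_insert_iff, Set.mem_singleton_iff] at ht
      rcases ht with rfl | rfl
      · rcases hM with h | h
        · exact h.2
        · exfalso; omega
      · exact ryw
    · right
      intro t ht
      simp only [Set.mem_insert_iff, Set.mem_singleton_iff] at ht
      rcases ht with rfl | rfl
      · exact rxz
      · rcases bwz with h | h
        · exfalso; omega
        · exact h.2
  rcases hP.2 _ hhom with h | h
  · rw [Set.ncard_pair hxw.ne] at h; omega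
  · have : y ∈ ({x, w} : Set V) := by rw [h]; trivial
    simp only [Set.mem_insert_iff, Set.mem_singleton_iff] at this
    rcases this with h | h
    · exact hxy.ne h.symm
    · exact hwy h.symm

/-- a good starting vertex -/
theorem Hyp.start [Fintype V] {T : Tournament V} {p q : V → ℕ} (H : Hyp T p q)
    (hP : T.PrimeOn Set.univ) {a b : V} (hab : Inv p q a b) :
    ∃ x y, Inv p q x y ∧ (∀ v, Inv p q x v → v = y) ∧ ∀ v, ¬ Lt p q v x := by
  obtain ⟨x, -, hx⟩ := Finset.exists_min_image (Finset.univ : Finset V) p ⟨a, Finset.mem_univ _⟩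
  obtain ⟨y, -, hy⟩ := Finset.exists_min_image (Finset.univ : Finset V) q ⟨a, Finset.mem_univ _⟩
  have hx : ∀ v, p x ≤ p v := fun v => hx v (Finset.mem_univ _)
  have hy : ∀ v, q y ≤ q v := fun v => hy v (Finset.mem_univ _)
  have hxmin : ∀ v, ¬ Lt p q v x := fun v h => by have := hx v; unfold Lt at h; omega
  have hymin : ∀ v, ¬ Lt p q v y := fun v h => by have := hy v; unfold Lt at h; omega
  have hnb : ∀ v, ∃ u, Inv p q v u := by
    intro v
    rcases Relation.ReflTransGen.cases_tail (H.reach hP hab v) with h | ⟨c, _, h⟩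
    · exact ⟨b, h ▸ hab⟩
    · exact ⟨c, h.symm⟩
  have hne : x ≠ y := by
    rintro rfl
    obtain ⟨u, hu⟩ := hnb x
    have := hx u
    have := hy u
    unfold Inv at hu; omega
  have hxy : Inv p q x y := by
    rcases H.tri x y hne with h | h | h
    · exact h
    · exact (hymin _ h).elim
    · exact (hxmin _ h).elim
  by_cases c1 : ∀ v, Inv p q x v → v = y
  · exact ⟨x, y, hxy, c1, hxmin⟩
  by_cases c2 : ∀ v, Inv p q y v → v = x
  · exact ⟨y, x, hxy.symm, c2, hymin⟩
  exfalso
  push Not at c1 c2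
  obtain ⟨w, hxw, hwy⟩ := c1
  obtain ⟨z, hyz, hzx⟩ := c2
  have lxz : Lt p q x z := by
    rcases H.tri x z (Ne.symm hzx) with h | h | h
    · exact (H.notri hxy hyz h).elim
    · exact h
    · exact (hxmin _ h).elim
  have lyw : Lt p q y w := by
    rcases H.tri y w (Ne.symm hwy) with h | h | h
    · exact (H.notri hxy h hxw).elim
    · exact h
    · exact (hymin _ h).elim
  have hwz : Inv p q w z := by
    have := hx y
    have := hy x
    have := hx z
    have := hy w
    unfold Inv Lt at *
    omega
  rcases Inv.cases (T := T) hxy with ⟨h, -⟩ | ⟨h, -⟩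
  · exact H.noC4 hP hxy hxw hyz hwz lxz lyw h
      (by have := hx y; unfold Inv at hxy; omega)
  · exact H.swap.noC4 hP hxy.symm.swap hyz.swap hxw.swap hwz.symm.swap
      ⟨lyw.2, lyw.1⟩ ⟨lxz.2, lxz.1⟩ h.symm
      (by have := hy x; unfold Inv at hxy; omega)

/-- partial path of length `k` -/
def Path (p q : V → ℕ) (x y : V) (k : ℕ) (f : ℕ → V) : Prop :=
  f 0 = x ∧ f 1 = y ∧ (∀ i, i + 1 < k → Inv p q (f i) (f (i + 1))) ∧
    ∀ i j, i + 2 ≤ j → j < k → Lt p q (f i) (f j)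

theorem Path.inj {p q : V → ℕ} {x y : V} {k : ℕ} {f : ℕ → V} (h : Path p q x y k f)
    {i j : ℕ} (hij : i < j) (hj : j < k) : f i ≠ f j := by
  by_cases h1 : i + 1 = j
  · subst h1
    exact (h.2.2.1 i hj).ne
  · intro e
    have := h.2.2.2 i j (by omega) hj
    rw [e] at this
    unfold Lt at this; omega

theorem Hyp.extend {T : Tournament V} {p q : V → ℕ} (H : Hyp T p q) {x y : V}
    (h1 : ∀ v, Inv p q x v → v = y) (hmin : ∀ v, ¬ Lt p q v x) {k : ℕ} (hk : 2 ≤ k)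
    {f : ℕ → V} (hf : Path p q x y k f)
    (hnot : ¬ ∀ v, ∃ i < k, f i = v)
    (hr : ∀ v, Relation.ReflTransGen (Inv p q) x v) :
    ∃ g, Path p q x y (k + 1) g := by
  have hf0 := hf
  obtain ⟨f0, f1, fI, fL⟩ := hf
  -- vertices before the last have all their neighbours inside
  have full : ∀ i, i + 1 < k → ∀ v, Inv p q (f i) v → ∃ j < k, f j = v := by
    intro i hi v hv
    rcases Nat.eq_zero_or_pos i with rfl | hpos
    · rw [f0] at hv
      exact ⟨1, by omega, by rw [h1 v hv, f1]⟩
    · have a1 := fI (i - 1) (by omega)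
      rw [Nat.sub_add_cancel hpos] at a1
      have a2 := fI i hi
      have hne := Path.inj hf0 (i := i - 1) (j := i + 1) (by omega) hi
      rcases H.deg a1.symm a2 hne hv with h | h
      · exact ⟨i - 1, by omega, h.symm⟩
      · exact ⟨i + 1, by omega, h.symm⟩
  have hw : ∃ w, Inv p q (f (k - 1)) w ∧ ¬ ∃ i < k, f i = w := by
    by_contra hcon
    push Not at hcon
    apply hnot
    apply closed_univ hr {v | ∃ i < k, f i = v}
    · exact ⟨0, by omega, f0⟩
    · rintro u ⟨i, hi, rfl⟩ v hv
      by_cases hik : i + 1 < k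
      · exact full i hik v hv
      · have : i = k - 1 := by omega
        subst this
        exact hcon v hv
  obtain ⟨w, hw, hwn⟩ := hw
  have hni : ∀ i, i + 1 < k → ¬ Inv p q (f i) w := fun i hi h => hwn (full i hi w h)
  have hnew : ∀ i, i < k → f i ≠ w := fun i hi h => hwn ⟨i, hi, h⟩
  have low : ∀ i, i + 2 < k → Lt p q (f i) w := by
    intro i hi
    rcases H.tri (f i) w (hnew i (by omega)) with h | h | h
    · exact (hni i (by omega) h).elim
    · exact h
    · exfalso
      have := fL i (k - 1) (by omega) (by omega)
      unfold Lt at *; unfold Inv at hw; omega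
  have top : Lt p q (f (k - 2)) w := by
    rcases H.tri (f (k - 2)) w (hnew _ (by omega)) with h | h | h
    · exact (hni _ (by omega) h).elim
    · exact h
    · exfalso
      by_cases hk2 : k = 2
      · subst hk2
        rw [show 2 - 2 = 0 from rfl, f0] at h
        exact hmin _ h
      · have a1 := low (k - 3) (by omega)
        have a2 := fI (k - 3) (by omega)
        rw [show k - 3 + 1 = k - 2 by omega] at a2
        unfold Lt at *; unfold Inv at a2; omega
  refine ⟨fun i => if i < k then f i else w, ?_, ?_, ?_, ?_⟩
  · simp [f0]; omega
  · simp only [if_pos (show 1 < k by omega), f1]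
  · intro i hi
    by_cases hik : i + 1 < k
    · simp only [if_pos hik, if_pos (show i < k by omega)]
      exact fI i hik
    · have : i = k - 1 := by omega
      subst this
      simp only [if_neg hik, if_pos (show k - 1 < k by omega)]
      exact hw
  · intro i j hij hj
    by_cases hjk : j < k
    · simp only [if_pos hjk, if_pos (show i < k by omega)]
      exact fL i j hij hjk
    · simp only [if_neg hjk, if_pos (show i < k by omega)]
      by_cases h2 : i + 2 < k
      · exact low i h2
      · have : i = k - 2 := by omega
        subst this
        exact top

theorem Hyp.fullPath [Fintype V] {T : Tournament V} {p q : V → ℕ} (H : Hyp T p q)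
    (hP : T.PrimeOn Set.univ) {a b : V} (hab : Inv p q a b) :
    ∃ x y k f, 2 ≤ k ∧ Path p q x y k f ∧ ∀ v, ∃ i < k, f i = v := by
  obtain ⟨x, y, hxy, h1, hmin⟩ := H.start hP hab
  by_contra hcon
  push Not at hcon
  have hall : ∀ k, ∃ f, Path p q x y (k + 2) f := by
    intro k
    induction k with
    | zero =>
      refine ⟨fun i => if i = 0 then x else y, rfl, rfl, ?_, ?_⟩
      · intro i hi
        have : i = 0 := by omega
        subst this
        simpa using hxy
      · intro i j hij hj
        omega
    | succ k ih =>
      obtain ⟨f, hf⟩ := ih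
      refine H.extend h1 hmin (by omega) hf ?_ (H.reach hP hxy)
      intro h
      obtain ⟨v, hv⟩ := hcon x y (k + 2) f (by omega) hf
      obtain ⟨i, hi, e⟩ := h v
      exact hv i hi e
  obtain ⟨f, hf⟩ := hall (Fintype.card V)
  have : Function.Injective (fun i : Fin (Fintype.card V + 2) => f i) := by
    intro i j hij
    rcases lt_trichotomy i j with h | h | h
    · exact (hf.inj h j.2 hij).elim
    · exact h
    · exact (hf.inj h i.2 hij.symm).elim
  have := Fintype.card_le_of_injective _ this
  simp at this

theorem Hyp.main [Fintype V] {T : Tournament V} {p q : V → ℕ} (H : Hyp T p q)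
    (hP : T.PrimeOn Set.univ) {a b : V} (hab : Inv p q a b) :
    ∃ n : ℕ, T.IsoOnFin Set.univ (PPrel n) := by
  obtain ⟨x, y, k, f, hk, hf, hs⟩ := H.fullPath hP hab
  obtain ⟨-, -, fI, fL⟩ := id hf
  have hnb : ∀ i, i < k → ∃ u, Inv p q (f i) u := by
    intro i hi
    by_cases h : i + 1 < k
    · exact ⟨_, fI i h⟩
    · have := fI (i - 1) (by omega)
      rw [show i - 1 + 1 = i by omega] at this
      exact ⟨_, this.symm⟩
  have rL : ∀ i j, i + 2 ≤ j → j < k → T.rel (f i) (f j) := by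
    intro i j hij hj
    obtain ⟨u, hu⟩ := hnb i (by omega)
    exact (H.rel_of_lt hu).1 (fL i j hij hj)
  -- consistency of consecutive orientations
  have step : ∀ i, i + 2 < k → (T.rel (f (i + 1)) (f i) ↔ T.rel (f (i + 2)) (f (i + 1))) := by
    intro i hi
    have i1 := fI i (by omega)
    have i2 := fI (i + 1) (by omega)
    have l := fL i (i + 2) (by omega) hi
    have hne := hf.inj (i := i) (j := i + 2) (by omega) hi
    have c1 := Inv.cases (T := T) i1.symm
    have c2 := Inv.cases (T := T) i2
    have m1 := H.mp (f (i + 1)) (f i) (f (i + 2))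
    have m2 := H.mq (f (i + 1)) (f i) (f (i + 2))
    have a1 := T.asymm (f i) (f (i + 1))
    have a2 := T.asymm (f (i + 1)) (f (i + 2))
    have t1 := T.total _ _ i1.ne
    have t2 := T.total _ _ i2.ne
    rw [show i + 1 + 1 = i + 2 from rfl] at *
    unfold Inv at i1 i2
    unfold Lt at l
    unfold Bk at c1 c2 m1 m2
    grind
  have all : ∀ i, i + 1 < k → (T.rel (f 1) (f 0) ↔ T.rel (f (i + 1)) (f i)) := by
    intro i
    induction i with
    | zero => intro _; rfl
    | succ i ih => intro hi; exact (ih (by omega)).trans (step i (by omega))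
  by_cases hb : T.rel (f 1) (f 0)
  · refine ⟨k, fun i => f i, ?_, ?_, ?_⟩
    · intro i j hij
      rcases lt_trichotomy i j with h | h | h
      · exact (hf.inj h j.2 hij).elim
      · exact h
      · exact (hf.inj h i.2 hij.symm).elim
    · rw [Set.eq_univ_iff_forall]
      intro v
      obtain ⟨i, hi, e⟩ := hs v
      exact ⟨⟨i, hi⟩, e⟩
    · rintro ⟨i, hi⟩ ⟨j, hj⟩
      simp only [PPrel]
      constructor
      · rintro (h | h)
        · exact rL i j h hj
        · subst h; exact (all j hi).1 hb
      · intro h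
        by_contra hc
        push Not at hc
        rcases Nat.lt_trichotomy i j with hh | hh | hh
        · have : j = i + 1 := by omega
          subst this
          exact T.asymm _ _ h ((all i hj).1 hb)
        · subst hh; exact T.asymm _ _ h h
        · exact T.asymm _ _ h (rL j i (by omega) hi)
  · have fw : ∀ j, 0 < j → j < k → T.rel (f 0) (f j) := by
      intro j hj hjk
      by_cases h : j = 1
      · subst h
        rcases T.total (f 0) (f 1) (hf.inj (by omega) hjk) with h | h
        · exact h
        · exact (hb h).elim
      · exact rL 0 j (by omega) hjk
    have hhom : T.HomogOn Set.univ {v | v ≠ f 0} := by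
      refine ⟨Set.subset_univ _, ?_⟩
      rintro v ⟨-, hv⟩
      have hv : v = f 0 := by simpa using hv
      left
      intro w hw
      obtain ⟨j, hj, rfl⟩ := hs w
      rw [hv]
      refine fw j (Nat.pos_of_ne_zero ?_) hj
      rintro rfl
      exact hw rfl
    rcases hP.2 _ hhom with h | h
    · have k2 : k = 2 := by
        by_contra hk2
        have := (Set.ncard_le_one (Set.toFinite _)).1 h (f 1)
          (hf.inj (i := 0) (j := 1) (by omega) (by omega)).symm (f 2)
          (hf.inj (i := 0) (j := 2) (by omega) (by omega)).symm
        exact hf.inj (i := 1) (j := 2) (by omega) (by omega) this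
      subst k2
      have r01 := fw 1 (by omega) (by omega)
      have ne := hf.inj (i := 0) (j := 1) (by omega) (by omega)
      refine ⟨2, fun i => f (1 - i), ?_, ?_, ?_⟩
      · intro i j hij
        fin_cases i <;> fin_cases j <;> simp_all
      · rw [Set.eq_univ_iff_forall]
        intro v
        obtain ⟨i, hi, e⟩ := hs v
        refine ⟨⟨1 - i, by omega⟩, ?_⟩
        rw [← e]
        simp only
        congr 1
        omega
      · have q0 : ¬ T.rel (f 1) (f 0) := fun h => T.asymm _ _ h r01
        have q1 : ∀ v, ¬ T.rel v v := fun v h => T.asymm _ _ h h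
        intro i j
        fin_cases i <;> fin_cases j <;> simp [PPrel, q0, q1, r01]
    · exfalso
      have : f 0 ∈ {v | v ≠ f 0} := by rw [h]; trivial
      exact this rfl

end MO

/-- Every prime tournament which is not isomorphic to `P_n` for any `n` has at most one
matching ordering. -/
theorem stmt12 {V : Type} [Fintype V] (T : Tournament V)
    (hP : T.PrimeOn Set.univ)
    (hnotP : ¬ ∃ n : ℕ, T.IsoOnFin Set.univ (PPrel n)) :
    ∀ (m : ℕ) (e e' : Fin m → V),
      MatchingOrd T.rel e → MatchingOrd T.rel e' → e = e' := by
  intro m e e' he he'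
  have gen : ∀ g : Fin m → V, MatchingOrd T.rel g → ∃ p : V → Fin m,
      (∀ i, p (g i) = i) ∧ (∀ v, g (p v) = v) ∧
      ∀ u v w, MO.Bk T (fun v => (p v : ℕ)) u v → MO.Bk T (fun v => (p v : ℕ)) u w → v = w := by
    intro g hg
    let E := Equiv.ofBijective g hg.1
    have h1 : ∀ i, E.symm (g i) = i := fun i => E.symm_apply_apply i
    have h2 : ∀ v, g (E.symm v) = v := fun v => E.apply_symm_apply v
    refine ⟨E.symm, h1, h2, ?_⟩
    intro u v w hv hw
    have := @hg.2 (E.symm u) (E.symm v) (by simpa [h2, MO.Bk] using hv) (E.symm w)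
      (by simpa [h2, MO.Bk] using hw)
    exact E.symm.injective this
  obtain ⟨p, p1, p2, p3⟩ := gen e he
  obtain ⟨q, q1, q2, q3⟩ := gen e' he'
  have H : MO.Hyp T (fun v => (p v : ℕ)) (fun v => (q v : ℕ)) := by
    refine ⟨fun u v h => ?_, fun u v h => ?_, p3, q3⟩
    · rw [← p2 u, ← p2 v, Fin.ext h]
    · rw [← q2 u, ← q2 v, Fin.ext h]
  have hno : ∀ u v, ¬ MO.Inv (fun v => (p v : ℕ)) (fun v => (q v : ℕ)) u v :=
    fun u v h => hnotP (H.main hP h)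
  have mono : StrictMono (fun i => q (e i)) := by
    intro i j hij
    by_contra hc
    have hne : e i ≠ e j := fun h => hij.ne (he.1.1 h)
    rcases H.tri _ _ hne with h | h | h
    · exact hno _ _ h
    · exact hc h.2
    · have := h.1
      simp only [p1] at this
      exact absurd hij (not_lt.2 (le_of_lt this))
  have hid : (fun i => q (e i)) = id := by
    apply (StrictMono.range_inj mono strictMono_id).1
    rw [Set.range_id, Set.range_eq_univ]
    intro i
    exact ⟨p (e' i), by simp only [p2, q1]⟩
  funext i
  have := congrFun hid i
  simp only [id] at this
  rw [← q2 (e i), this]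
end

section
/- The tournament P_n has exactly one matching ordering for n = 1, exactly three matching orderings for n = 3 and n = 4, and exactly two matching orderings for all other n ≥ 2. -/
/-- A position function (inverse of an ordering) for which the backedges form a matching. -/
def GoodPos (n : ℕ) (p : Fin n → Fin n) : Prop :=
  Function.Injective p ∧ ∀ u v w : Fin n,
    ((p u < p v ∧ PPrel n v u) ∨ (p v < p u ∧ PPrel n u v)) →
    ((p u < p w ∧ PPrel n w u) ∨ (p w < p u ∧ PPrel n u w)) → v = w

lemma goodPos_of {n : ℕ} {e : Fin n → Fin n} (h : MatchingOrd (PPrel n) e) :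
    GoodPos n (Equiv.ofBijective e h.1).symm := by
  have hs : ∀ u, e ((Equiv.ofBijective e h.1).symm u) = u :=
    fun u => (Equiv.ofBijective e h.1).apply_symm_apply u
  refine ⟨Equiv.injective _, fun u v w hv hw => ?_⟩
  have := h.2 ((Equiv.ofBijective e h.1).symm u)
    (x := (Equiv.ofBijective e h.1).symm v) (by simpa [hs] using hv)
    (y := (Equiv.ofBijective e h.1).symm w) (by simpa [hs] using hw)
  exact (Equiv.injective _) this

lemma GoodPos.key {n : ℕ} (hn : 5 ≤ n) {p : Fin n → Fin n} (hp : GoodPos n p)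
    (u v : Fin n) (huv : u.val + 2 ≤ v.val) : p u < p v := by
  by_contra hlt
  have hne : p u ≠ p v := fun h => by have := hp.1 h; subst this; omega
  have hlt : p v < p u := by omega
  -- no vertex `x` with `u → x → v`
  have no : ∀ x : Fin n, PPrel n u x → PPrel n x v → False := by
    intro x h1 h2
    have hxu : x ≠ u := by rintro rfl; unfold PPrel at h1; omega
    have hxv : x ≠ v := by rintro rfl; unfold PPrel at h2; omega
    have a1 : ¬ p x < p u := fun h =>
      hxv (hp.2 u x v (Or.inr ⟨h, h1⟩) (Or.inr ⟨hlt, Or.inl huv⟩))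
    have a2 : ¬ p v < p x := fun h =>
      hxu (hp.2 v x u (Or.inl ⟨h, h2⟩) (Or.inl ⟨hlt, Or.inl huv⟩))
    omega
  have hv := v.isLt
  have h3 : v.val ≤ u.val + 3 := by
    by_contra hc
    exact no ⟨u.val + 2, by omega⟩ (Or.inl (by simp)) (Or.inl (by simp; omega))
  have h0 : u.val = 0 := by
    by_contra hc
    exact no ⟨u.val - 1, by omega⟩ (Or.inr (by simp; omega)) (Or.inl (by simp; omega))
  have h4 : n ≤ v.val + 1 := by
    by_contra hc
    exact no ⟨v.val + 1, by omega⟩ (Or.inl (by simp; omega)) (Or.inr (by simp))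
  omega

lemma GoodPos.alt {n : ℕ} (hn : 5 ≤ n) {p : Fin n → Fin n} (hp : GoodPos n p)
    (a b c : Fin n) (hb : b.val = a.val + 1) (hc : c.val = a.val + 2) :
    p b < p c ↔ ¬ p a < p b := by
  have k := hp.key hn a c (by omega)
  constructor
  · intro h1 h2
    have := hp.2 b a c (Or.inr ⟨h2, Or.inr hb⟩) (Or.inl ⟨h1, Or.inr (by omega)⟩)
    subst this; omega
  · intro h
    omega

lemma GoodPos.uniq {n : ℕ} (hn : 5 ≤ n) {p q : Fin n → Fin n} (hp : GoodPos n p)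
    (hq : GoodPos n q)
    (h : p ⟨0, by omega⟩ < p ⟨1, by omega⟩ ↔ q ⟨0, by omega⟩ < q ⟨1, by omega⟩)
    (a b : Fin n) : p a < p b ↔ q a < q b := by
  have step : ∀ i : ℕ, ∀ hi : i + 1 < n,
      (p ⟨i, by omega⟩ < p ⟨i + 1, hi⟩ ↔ q ⟨i, by omega⟩ < q ⟨i + 1, hi⟩) := by
    intro i
    induction i with
    | zero => intro hi; exact h
    | succ i ih =>
      intro hi
      rw [hp.alt hn ⟨i, by omega⟩ ⟨i + 1, by omega⟩ ⟨i + 1 + 1, hi⟩ rfl rfl,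
        hq.alt hn ⟨i, by omega⟩ ⟨i + 1, by omega⟩ ⟨i + 1 + 1, hi⟩ rfl rfl, ih (by omega)]
  have main : ∀ a b : Fin n, a.val < b.val → (p a < p b ↔ q a < q b) := by
    intro a b hab
    by_cases h2 : a.val + 2 ≤ b.val
    · exact iff_of_true (hp.key hn a b h2) (hq.key hn a b h2)
    · obtain ⟨a, ha⟩ := a
      obtain ⟨b, hb⟩ := b
      obtain rfl : b = a + 1 := by simp at hab h2; omega
      exact step a hb
  rcases lt_trichotomy a b with hab | hab | hab
  · exact main a b hab
  · subst hab; simp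
  · have := main b a hab
    have h1 : p a ≠ p b := fun h => hab.ne' (hp.1 h)
    have h2 : q a ≠ q b := fun h => hab.ne' (hq.1 h)
    omega

lemma ord_uniq {n : ℕ} (hn : 5 ≤ n) {e f : Fin n → Fin n}
    (he : MatchingOrd (PPrel n) e) (hf : MatchingOrd (PPrel n) f)
    (h : (Equiv.ofBijective e he.1).symm ⟨0, by omega⟩ <
        (Equiv.ofBijective e he.1).symm ⟨1, by omega⟩ ↔
      (Equiv.ofBijective f hf.1).symm ⟨0, by omega⟩ <
        (Equiv.ofBijective f hf.1).symm ⟨1, by omega⟩) : e = f := by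
  have u := (goodPos_of he).uniq hn (goodPos_of hf) h
  set E := Equiv.ofBijective e he.1
  set F := Equiv.ofBijective f hf.1
  have hmono : StrictMono (fun i => F.symm (E i)) := by
    intro i j hij
    have := (u (E i) (E j)).1 (by simpa using hij)
    exact this
  have hid : (fun i => F.symm (E i)) = id := by
    apply StrictMono.range_inj hmono strictMono_id |>.1
    rw [Set.range_id]
    exact (E.trans F.symm).surjective.range_eq
  funext i
  have := congrFun hid i
  have h2 : E i = F i := by
    have h3 : F.symm (E i) = i := this
    exact (Equiv.symm_apply_eq F).1 h3
  exact h2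

lemma match_of_invol {n : ℕ} (f : ℕ → ℕ) (hlt : ∀ i, i < n → f i < n)
    (hinv : ∀ i, i < n → f (f i) = i)
    (hm : ∀ i j k, i < n → j < n → k < n →
      ((i < j ∧ (f j + 2 ≤ f i ∨ f j = f i + 1)) ∨ (j < i ∧ (f i + 2 ≤ f j ∨ f i = f j + 1))) →
      ((i < k ∧ (f k + 2 ≤ f i ∨ f k = f i + 1)) ∨ (k < i ∧ (f i + 2 ≤ f k ∨ f i = f k + 1))) →
      j = k) :
    MatchingOrd (PPrel n) (fun i : Fin n => (⟨f i.val, hlt _ i.isLt⟩ : Fin n)) := by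
  refine ⟨Function.Involutive.bijective (fun i => Fin.ext (hinv _ i.isLt)), ?_⟩
  intro i j hj k hk
  exact Fin.ext (hm i.val j.val k.val i.isLt j.isLt k.isLt hj hk)

lemma pi1_ok (n : ℕ) : ∃ e : Fin n → Fin n, MatchingOrd (PPrel n) e ∧
    ∀ i, (e i).val = pi1N 0 (n - 1) i.val := by
  refine ⟨_, match_of_invol (pi1N 0 (n - 1)) ?_ ?_ ?_, fun i => rfl⟩
  · intro i hi; unfold pi1N; split_ifs <;> omega
  · intro i hi; unfold pi1N; split_ifs <;> omega
  · intro i j k hi hj hk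
    have h : ∀ i, i < n → (i % 2 = 0 ∧ i + 1 < n ∧ pi1N 0 (n - 1) i = i + 1) ∨
        (i % 2 = 0 ∧ i + 1 = n ∧ pi1N 0 (n - 1) i = i) ∨
        (i % 2 = 1 ∧ pi1N 0 (n - 1) i + 1 = i) := by
      intro i hi; unfold pi1N; split_ifs <;> omega
    have := h i hi
    have := h j hj
    have := h k hk
    omega

lemma pi2_ok (n : ℕ) : ∃ e : Fin n → Fin n, MatchingOrd (PPrel n) e ∧
    ∀ i, (e i).val = pi2N 0 (n - 1) i.val := by
  have h : ∀ i, i < n → (i % 2 = 1 ∧ i + 1 < n ∧ pi2N 0 (n - 1) i = i + 1) ∨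
      (i % 2 = 1 ∧ i + 1 = n ∧ pi2N 0 (n - 1) i = i) ∨
      (i % 2 = 0 ∧ i = 0 ∧ pi2N 0 (n - 1) i = 0) ∨
      (i % 2 = 0 ∧ 0 < i ∧ pi2N 0 (n - 1) i + 1 = i) := by
    intro i hi; unfold pi2N; split_ifs <;> omega
  refine ⟨_, match_of_invol (pi2N 0 (n - 1)) ?_ ?_ ?_, fun i => rfl⟩
  · intro i hi; unfold pi2N; split_ifs <;> omega
  · intro i hi
    have h1 := h i hi
    have h2 := h (pi2N 0 (n - 1) i) (by omega)
    omega
  · intro i j k hi hj hk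
    have := h i hi
    have := h j hj
    have := h k hk
    omega

lemma card_large (n : ℕ) (hn : 5 ≤ n) :
    Nat.card {e : Fin n → Fin n // MatchingOrd (PPrel n) e} = 2 := by
  obtain ⟨e, he, he'⟩ := pi1_ok n
  obtain ⟨f, hf, hf'⟩ := pi2_ok n
  have pos : ∀ (g : Fin n → Fin n) (hg : Function.Bijective g) (i j : Fin n), g i = j →
      (Equiv.ofBijective g hg).symm j = i := by
    intro g hg i j hij
    rw [Equiv.symm_apply_eq]; exact hij.symm
  have e0 : ¬ (Equiv.ofBijective e he.1).symm ⟨0, by omega⟩ <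
      (Equiv.ofBijective e he.1).symm ⟨1, by omega⟩ := by
    rw [pos e he.1 ⟨1, by omega⟩ ⟨0, by omega⟩ (Fin.ext (by rw [he']; unfold pi1N; split_ifs <;> simp at * <;> omega)),
      pos e he.1 ⟨0, by omega⟩ ⟨1, by omega⟩ (Fin.ext (by rw [he']; unfold pi1N; split_ifs <;> simp at * <;> omega))]
    simp
  have f0 : (Equiv.ofBijective f hf.1).symm ⟨0, by omega⟩ <
      (Equiv.ofBijective f hf.1).symm ⟨1, by omega⟩ := by
    rw [pos f hf.1 ⟨0, by omega⟩ ⟨0, by omega⟩ (Fin.ext (by rw [hf']; unfold pi2N; split_ifs <;> simp at * <;> omega)),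
      pos f hf.1 ⟨2, by omega⟩ ⟨1, by omega⟩ (Fin.ext (by rw [hf']; unfold pi2N; split_ifs <;> simp at * <;> omega))]
    simp
  rw [Nat.card_eq_two_iff]
  refine ⟨⟨e, he⟩, ⟨f, hf⟩, ?_, ?_⟩
  · intro h
    have h : e = f := congrArg Subtype.val h
    subst h
    exact e0 f0
  · ext ⟨g, hg⟩
    simp only [Set.mem_insert_iff, Set.mem_singleton_iff, Set.mem_univ, iff_true, Subtype.mk.injEq]
    by_cases h : (Equiv.ofBijective g hg.1).symm ⟨0, by omega⟩ <
        (Equiv.ofBijective g hg.1).symm ⟨1, by omega⟩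
    · exact Or.inr (ord_uniq hn hg hf (iff_of_true h f0))
    · exact Or.inl (ord_uniq hn hg he (iff_of_false h e0))

instance (n : ℕ) (i j : Fin n) : Decidable (PPrel n i j) := by unfold PPrel; infer_instance

lemma match_iff (n : ℕ) (e : Fin n → Fin n) : MatchingOrd (PPrel n) e ↔
    (∀ i j, e i = e j → i = j) ∧ ∀ i j k : Fin n,
      ((i < j ∧ PPrel n (e j) (e i)) ∨ (j < i ∧ PPrel n (e i) (e j))) →
      ((i < k ∧ PPrel n (e k) (e i)) ∨ (k < i ∧ PPrel n (e i) (e k))) → j = k := by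
  unfold MatchingOrd
  rw [← Finite.injective_iff_bijective]
  constructor
  · rintro ⟨h1, h2⟩
    exact ⟨fun i j h => h1 h, fun i j k hj hk => h2 i hj hk⟩
  · rintro ⟨h1, h2⟩
    exact ⟨fun i j h => h1 i j h, fun i j hj k hk => h2 i j k hj hk⟩

instance (n : ℕ) (e : Fin n → Fin n) : Decidable (MatchingOrd (PPrel n) e) :=
  decidable_of_iff' _ (match_iff n e)

set_option maxRecDepth 100000 in
set_option maxHeartbeats 4000000 in
/-- `P_n` has exactly one matching ordering for `n = 1`, exactly three for `n = 3, 4`,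
and exactly two for all other `n`. -/
theorem stmt13 (n : ℕ) (hn : 1 ≤ n) :
    Nat.card {e : Fin n → Fin n // MatchingOrd (PPrel n) e} =
      if n = 1 then 1 else if n = 3 ∨ n = 4 then 3 else 2 := by
  by_cases h5 : 5 ≤ n
  · rw [card_large n h5, if_neg (by omega), if_neg (by omega)]
  · have : n = 1 ∨ n = 2 ∨ n = 3 ∨ n = 4 := by omega
    rcases this with rfl | rfl | rfl | rfl <;> rw [Nat.card_eq_fintype_card]
    · decide +kernel
    · decide +kernel
    · decide +kernel
    · decide +kernel
end

section
/- The transitive tournament I_n on n vertices has exactly F_n matching orderings, where {F_i}_{i≥0} are the Fibonacci numbers defined by F_0 = F_1 = 1 and F_i = F_{i−1} + F_{i−2} for i ≥ 2. -/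
/-- The Fibonacci numbers with `F_0 = F_1 = 1`. -/
def fibF : ℕ → ℕ
  | 0 => 1
  | 1 => 1
  | n + 2 => fibF (n + 1) + fibF n

/-- Positions `i` and `j` are joined by a backedge of the ordering `e` of `I_n`. -/
def InvAt {n : ℕ} (e : Fin n → Fin n) (i j : Fin n) : Prop :=
  (i < j ∧ e j < e i) ∨ (j < i ∧ e i < e j)

theorem matchingOrd_iff {n : ℕ} (e : Fin n → Fin n) :
    MatchingOrd (fun i j : Fin n => i < j) e ↔
      Function.Injective e ∧ ∀ i j k, InvAt e i j → InvAt e i k → j = k := by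
  unfold MatchingOrd
  rw [← Finite.injective_iff_bijective]
  refine and_congr_right fun _ => ?_
  constructor
  · intro h i j k hj hk
    exact h i hj hk
  · intro h i j hj k hk
    exact h i j k hj hk

/-- Prepend a fixed first vertex. -/
def ext1 {n : ℕ} (e : Fin n → Fin n) : Fin (n + 1) → Fin (n + 1) :=
  Fin.cons 0 (fun i => (e i).succ)

/-- Prepend a swapped pair of vertices. -/
def ext2 {n : ℕ} (e : Fin n → Fin n) : Fin (n + 2) → Fin (n + 2) :=
  Fin.cons 1 (Fin.cons 0 (fun i => (e i).succ.succ))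

@[simp] theorem ext1_zero {n : ℕ} (e : Fin n → Fin n) : ext1 e 0 = 0 := rfl
@[simp] theorem ext1_succ {n : ℕ} (e : Fin n → Fin n) (i : Fin n) :
    ext1 e i.succ = (e i).succ := rfl
@[simp] theorem ext2_zero {n : ℕ} (e : Fin n → Fin n) : ext2 e 0 = 1 := rfl
@[simp] theorem ext2_one {n : ℕ} (e : Fin n → Fin n) : ext2 e 1 = 0 := rfl
@[simp] theorem ext2_one' {n : ℕ} (e : Fin n → Fin n) : ext2 e (Fin.succ 0) = 0 := rfl
@[simp] theorem ext2_succ {n : ℕ} (e : Fin n → Fin n) (i : Fin n) :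
    ext2 e i.succ.succ = (e i).succ.succ := rfl

theorem inv1_ss {n : ℕ} (e : Fin n → Fin n) (i j : Fin n) :
    InvAt (ext1 e) i.succ j.succ ↔ InvAt e i j := by simp [InvAt]
theorem inv1_zl {n : ℕ} (e : Fin n → Fin n) (j : Fin (n + 1)) :
    ¬ InvAt (ext1 e) 0 j := by simp [InvAt]
theorem inv1_zr {n : ℕ} (e : Fin n → Fin n) (j : Fin (n + 1)) :
    ¬ InvAt (ext1 e) j 0 := by simp [InvAt]

theorem inv2_ss {n : ℕ} (e : Fin n → Fin n) (i j : Fin n) :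
    InvAt (ext2 e) i.succ.succ j.succ.succ ↔ InvAt e i j := by simp [InvAt]
theorem inv2_zs {n : ℕ} (e : Fin n → Fin n) (j : Fin n) :
    ¬ InvAt (ext2 e) 0 j.succ.succ := by
  simp only [InvAt, ext2_zero, ext2_succ, Fin.lt_def, Fin.val_succ, Fin.val_zero, Fin.val_one]
  omega
theorem inv2_sz {n : ℕ} (e : Fin n → Fin n) (j : Fin n) :
    ¬ InvAt (ext2 e) j.succ.succ 0 := by
  simp only [InvAt, ext2_zero, ext2_succ, Fin.lt_def, Fin.val_succ, Fin.val_zero, Fin.val_one]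
  omega
theorem inv2_os {n : ℕ} (e : Fin n → Fin n) (j : Fin n) :
    ¬ InvAt (ext2 e) (Fin.succ 0) j.succ.succ := by
  simp only [InvAt, ext2_one', ext2_succ, Fin.lt_def, Fin.val_succ, Fin.val_zero]
  omega
theorem inv2_so {n : ℕ} (e : Fin n → Fin n) (j : Fin n) :
    ¬ InvAt (ext2 e) j.succ.succ (Fin.succ 0) := by
  simp only [InvAt, ext2_one', ext2_succ, Fin.lt_def, Fin.val_succ, Fin.val_zero]
  omega
theorem inv_irrefl {n : ℕ} (e : Fin n → Fin n) (i : Fin n) : ¬ InvAt e i i := by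
  simp [InvAt]

theorem ext1_good {n : ℕ} (e : Fin n → Fin n) :
    MatchingOrd (fun i j : Fin (n + 1) => i < j) (ext1 e) ↔
      MatchingOrd (fun i j : Fin n => i < j) e := by
  rw [matchingOrd_iff, matchingOrd_iff]
  refine and_congr ?_ ?_
  · constructor
    · intro h i j hij
      exact Fin.succ_injective _ (h (by simp [hij]))
    · intro h i j hij
      cases i using Fin.cases <;> cases j using Fin.cases <;>
        simp_all [(Fin.succ_ne_zero _).symm, h.eq_iff]
  · constructor
    · intro h i j k hj hk
      exact Fin.succ_injective _
        (h i.succ j.succ k.succ ((inv1_ss e i j).2 hj) ((inv1_ss e i k).2 hk))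
    · intro h i j k hj hk
      cases i using Fin.cases with
      | zero => exact absurd hj (inv1_zl e _)
      | succ i =>
        cases j using Fin.cases with
        | zero => exact absurd hj (inv1_zr e _)
        | succ j =>
          cases k using Fin.cases with
          | zero => exact absurd hk (inv1_zr e _)
          | succ k =>
            rw [h i j k ((inv1_ss e i j).1 hj) ((inv1_ss e i k).1 hk)]

theorem fin_cases2 {n : ℕ} {P : Fin (n + 2) → Prop} (h0 : P 0) (h1 : P (Fin.succ 0))
    (h2 : ∀ i : Fin n, P i.succ.succ) (i : Fin (n + 2)) : P i :=
  Fin.cases h0 (fun i => Fin.cases h1 h2 i) i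

theorem ext2_good {n : ℕ} (e : Fin n → Fin n) :
    MatchingOrd (fun i j : Fin (n + 2) => i < j) (ext2 e) ↔
      MatchingOrd (fun i j : Fin n => i < j) e := by
  rw [matchingOrd_iff, matchingOrd_iff]
  refine and_congr ?_ ?_
  · constructor
    · intro h i j hij
      exact Fin.succ_injective _ (Fin.succ_injective _ (h (by simp [hij])))
    · intro h i j hij
      induction i using fin_cases2 <;> induction j using fin_cases2 <;>
        simp_all [(Fin.succ_ne_zero _).symm, Fin.ext_iff]
      exact congrArg Fin.val (h (Fin.ext hij))
  · constructor
    · intro h i j k hj hk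
      exact Fin.succ_injective _ (Fin.succ_injective _
        (h _ _ _ ((inv2_ss e i j).2 hj) ((inv2_ss e i k).2 hk)))
    · intro h i j k hj hk
      induction i using fin_cases2 <;> induction j using fin_cases2 <;>
        induction k using fin_cases2 <;>
        simp only [inv_irrefl, inv2_so, inv2_os, inv2_sz, inv2_zs, inv2_ss] at hj hk ⊢
      rw [h _ _ _ hj hk]

theorem good_start {n : ℕ} (f : Fin (n + 2) → Fin (n + 2))
    (hf : MatchingOrd (fun i j : Fin (n + 2) => i < j) f) :
    f 0 = 0 ∨ (f 0 = 1 ∧ f 1 = 0) := by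
  have hs := hf.1.2
  obtain ⟨hi, hm⟩ := (matchingOrd_iff f).1 hf
  obtain ⟨a, ha⟩ := hs 0
  obtain ⟨b, hb⟩ := hs 1
  by_cases ha0 : a = 0
  · left; rw [ha0] at ha; exact ha
  right
  have h0 : f 0 ≠ 0 := fun h => ha0 (hi (ha.trans h.symm))
  have hinv : InvAt f 0 a := Or.inl ⟨Fin.pos_iff_ne_zero.2 ha0, by
    rw [ha]; exact Fin.pos_iff_ne_zero.2 h0⟩
  have h1 : f 0 = 1 := by
    by_contra h1
    have hb0 : b ≠ 0 := by rintro rfl; exact h1 hb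
    have hinv' : InvAt f 0 b := Or.inl ⟨Fin.pos_iff_ne_zero.2 hb0, by
      rw [hb]
      simp only [Fin.lt_def, Fin.ext_iff, ne_eq, Fin.val_zero, Fin.val_one] at h0 h1 ⊢
      omega⟩
    have := hm _ _ _ hinv hinv'
    rw [this, hb] at ha
    simp at ha
  refine ⟨h1, ?_⟩
  by_contra h10
  have ha1 : a ≠ 1 := by rintro rfl; exact h10 ha
  have i0 : InvAt f a 0 := Or.inr ⟨Fin.pos_iff_ne_zero.2 ha0, by
    rw [ha]; exact Fin.pos_iff_ne_zero.2 h0⟩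
  have i1 : InvAt f a 1 := Or.inr ⟨by
      simp only [Fin.lt_def, Fin.ext_iff, ne_eq, Fin.val_zero, Fin.val_one] at ha0 ha1 ⊢
      omega, by
    rw [ha]; exact Fin.pos_iff_ne_zero.2 h10⟩
  have := hm _ _ _ i0 i1
  simp at this

/-- The matching orderings of `I_n`. -/
abbrev MOrd (n : ℕ) : Type :=
  {e : Fin n → Fin n // MatchingOrd (fun i j : Fin n => i < j) e}

/-- The map realizing the Fibonacci recursion. -/
def stepMap (n : ℕ) : MOrd (n + 1) ⊕ MOrd n → MOrd (n + 2) :=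
  Sum.elim (fun e => ⟨ext1 e.1, (ext1_good e.1).2 e.2⟩)
    (fun e => ⟨ext2 e.1, (ext2_good e.1).2 e.2⟩)

theorem stepMap_bij (n : ℕ) : Function.Bijective (stepMap n) := by
  constructor
  · rintro (⟨e, he⟩ | ⟨e, he⟩) (⟨e', he'⟩ | ⟨e', he'⟩) h
    · have h' : ext1 e = ext1 e' := congrArg Subtype.val h
      have : e = e' := funext fun i => Fin.succ_injective _ (congrFun h' i.succ)
      subst this; rfl
    · have h' : ext1 e = ext2 e' := congrArg Subtype.val h
      have := congrFun h' 0
      simp at this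
    · have h' : ext2 e = ext1 e' := congrArg Subtype.val h
      have := congrFun h' 0
      simp at this
    · have h' : ext2 e = ext2 e' := congrArg Subtype.val h
      have : e = e' := funext fun i => Fin.succ_injective _
        (Fin.succ_injective _ (congrFun h' i.succ.succ))
      subst this; rfl
  · rintro ⟨f, hf⟩
    have hi := hf.1.1
    rcases good_start f hf with h0 | ⟨h0, h1⟩
    · have key : ∀ i : Fin (n + 1), ∃ x : Fin (n + 1), x.succ = f i.succ := fun i =>
        Fin.exists_succ_eq.2 fun h => Fin.succ_ne_zero i (hi (h.trans h0.symm))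
      choose g hg using key
      have hfg : ext1 g = f := by
        funext i
        cases i using Fin.cases with
        | zero => exact h0.symm
        | succ i => exact hg i
      subst hfg
      exact ⟨Sum.inl ⟨g, (ext1_good g).1 hf⟩, rfl⟩
    · have key : ∀ i : Fin n, ∃ x : Fin n, x.succ.succ = f i.succ.succ := fun i => by
        obtain ⟨y, hy⟩ := Fin.exists_succ_eq.2 (fun h : f i.succ.succ = 0 => by
          have := hi (h.trans h1.symm)
          simp [Fin.ext_iff] at this)
        obtain ⟨x, hx⟩ := Fin.exists_succ_eq.2 (fun h : y = 0 => by
          have h2 : f i.succ.succ = 1 := by rw [← hy, h]; rfl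
          exact Fin.succ_ne_zero _ (hi (h2.trans h0.symm)))
        exact ⟨x, by rw [hx, hy]⟩
      choose g hg using key
      have hfg : ext2 g = f := by
        funext i
        induction i using fin_cases2 with
        | h0 => exact h0.symm
        | h1 => exact h1.symm
        | h2 i => exact hg i
      subst hfg
      exact ⟨Sum.inr ⟨g, (ext2_good g).1 hf⟩, rfl⟩

theorem mOrd_card_small (n : ℕ) [Subsingleton (Fin n)] : Nat.card (MOrd n) = 1 := by
  have : Nonempty (MOrd n) :=
    ⟨⟨id, Function.bijective_id, fun _ _ _ _ _ => Subsingleton.elim _ _⟩⟩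
  exact Nat.card_eq_one_iff_unique.2 ⟨inferInstance, this⟩

theorem mOrd_card : ∀ n : ℕ, Nat.card (MOrd n) = fibF n
  | 0 => mOrd_card_small 0
  | 1 => mOrd_card_small 1
  | n + 2 => by
    rw [← Nat.card_congr (Equiv.ofBijective _ (stepMap_bij n)), Nat.card_sum,
      mOrd_card (n + 1), mOrd_card n, fibF]

/-- The transitive tournament `I_n` has exactly `F_n` matching orderings. -/
theorem stmt14 (n : ℕ) :
    Nat.card {e : Fin n → Fin n // MatchingOrd (fun i j : Fin n => i < j) e} =
      fibF n := by
  exact mOrd_card n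
end

section
/- For every odd n ≥ 7, the tournament Q_n is a minimal non-matching tournament: Q_n is not a matching tournament, but every subtournament of Q_n with fewer than n vertices is a matching tournament. Consequently, there are infinitely many (pairwise non-isomorphic) minimal non-matching tournaments. -/
/-- A position function with a mate function bounding the backedges yields a matching ordering. -/
lemma isMatchingOn_of_pos {n : ℕ} (r : Fin n → Fin n → Prop) (S : Set (Fin n)) (p mate : ℕ → ℕ)
    (inj : ∀ u ∈ S, ∀ v ∈ S, p u.val = p v.val → u.val = v.val)
    (h : ∀ u ∈ S, ∀ v ∈ S, p u.val < p v.val → r v u →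
      v.val = mate u.val ∧ u.val = mate v.val) :
    IsMatchingOn r S := by
  classical
  let F : Finset ℕ := (S.toFinite.toFinset).image (fun u => p u.val)
  have hF : ∀ i : Fin F.card, ∃ u, u ∈ S ∧ p u.val = F.orderEmbOfFin rfl i := by
    intro i
    have := F.orderEmbOfFin_mem rfl i
    obtain ⟨u, hu, hu'⟩ := Finset.mem_image.mp this
    exact ⟨u, by simpa using hu, hu'⟩
  choose e heS hep using hF
  refine ⟨F.card, e, ⟨fun i _ => heS i, ?_, ?_⟩, ?_⟩
  · intro i _ j _ hij
    apply (F.orderEmbOfFin rfl).injective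
    rw [← hep, ← hep, hij]
  · intro u hu
    have hm : p u.val ∈ F := by
      simp only [F, Finset.mem_image]
      exact ⟨u, by simpa using hu, rfl⟩
    have : p u.val ∈ Set.range (F.orderEmbOfFin rfl) := by
      rw [Finset.range_orderEmbOfFin]; exact hm
    obtain ⟨i, hi⟩ := this
    refine ⟨i, trivial, ?_⟩
    apply Fin.ext
    apply inj _ (heS i) _ hu
    rw [hep, hi]
  · have hlt : ∀ i j, i < j → p (e i).val < p (e j).val := by
      intro i j hij
      rw [hep, hep]
      exact (F.orderEmbOfFin rfl).strictMono hij
    have key : ∀ i j, ((i < j ∧ r (e j) (e i)) ∨ (j < i ∧ r (e i) (e j))) →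
        (e j).val = mate (e i).val := by
      rintro i j (⟨h1, h2⟩ | ⟨h1, h2⟩)
      · exact (h _ (heS i) _ (heS j) (hlt _ _ h1) h2).1
      · exact (h _ (heS j) _ (heS i) (hlt _ _ h1) h2).2
    intro i j hj k hk
    have h1 := key i j hj
    have h2 := key i k hk
    have h3 : e j = e k := Fin.ext (h1.trans h2.symm)
    apply (F.orderEmbOfFin rfl).injective
    rw [← hep, ← hep, h3]

/-- Left scheme position: `1 0 3 2 5 4 …`. -/
def posL (i : ℕ) : ℕ := if i % 2 = 0 then i + 1 else i - 1
/-- Right scheme position: `… m-2 m-3 m m-1`. -/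
def posR (i : ℕ) : ℕ := if i % 2 = 0 then i else i + 2

def posPath (n x i : ℕ) : ℕ :=
  if n - 3 < i then i + 10 else if i < x then posL i else posR i
def matePath (n x i : ℕ) : ℕ :=
  if i = n - 1 then n - 3 else if i = n - 2 then 0 else
  if i < x then (if i = 0 then n - 2 else if i % 2 = 0 then i - 1 else i + 1)
  else (if i = n - 3 then n - 1 else if i % 2 = 0 then i + 1 else i - 1)

def posEnd (n i : ℕ) : ℕ :=
  if i = n - 1 then n + 10 else if i = n - 2 then n + 30 else if i = n - 3 then n + 20 else posL i
def mateEnd (n i : ℕ) : ℕ :=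
  if i = n - 2 then 0 else
  if i = 0 then n - 2 else if i % 2 = 0 then i - 1 else i + 1

lemma path_mate (n x u v : ℕ) (hn2 : n % 2 = 1) (h7 : 7 ≤ n) (hx : x ≤ n - 3)
    (hu : u < n) (hv : v < n) (hux : u ≠ x) (hvx : v ≠ x)
    (h1 : posPath n x u < posPath n x v)
    (h2 : (v < u ∧ ¬ Qback n v u) ∨ (u < v ∧ Qback n u v)) :
    v = matePath n x u ∧ u = matePath n x v := by
  rcases h2 with ⟨h2, h3⟩ | ⟨h2, h3⟩
  · exfalso
    apply h3
    unfold Qback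
    unfold posPath posL posR at h1
    split_ifs at h1 <;> omega
  · rcases h3 with ⟨rfl, rfl⟩ | ⟨rfl, rfl⟩ | ⟨rfl, h3⟩
    · unfold matePath; constructor <;> split_ifs <;> omega
    · unfold matePath; constructor <;> split_ifs <;> omega
    · have h4 : (u + 1 < x ∧ u % 2 = 1) ∨ (x < u ∧ u % 2 = 0) := by
        unfold posPath posL posR at h1
        split_ifs at h1 <;> omega
      clear h1
      unfold matePath; constructor <;> (repeat' split) <;> omega

lemma end_mate (n x u v : ℕ) (hn2 : n % 2 = 1) (h7 : 7 ≤ n) (hx : n - 3 < x) (hxn : x < n)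
    (hu : u < n) (hv : v < n) (hux : u ≠ x) (hvx : v ≠ x)
    (h1 : posEnd n u < posEnd n v)
    (h2 : (v < u ∧ ¬ Qback n v u) ∨ (u < v ∧ Qback n u v)) :
    v = mateEnd n u ∧ u = mateEnd n v := by
  rcases h2 with ⟨h2, h3⟩ | ⟨h2, h3⟩
  · exfalso
    apply h3
    unfold Qback
    unfold posEnd posL at h1
    split_ifs at h1 <;> omega
  · rcases h3 with ⟨rfl, rfl⟩ | ⟨rfl, rfl⟩ | ⟨rfl, h3⟩
    · unfold mateEnd; constructor <;> split_ifs <;> omega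
    · exfalso
      unfold posEnd posL at h1
      split_ifs at h1 <;> omega
    · have h4 : u % 2 = 1 := by
        unfold posEnd posL at h1
        split_ifs at h1 <;> omega
      clear h1
      unfold mateEnd; constructor <;> (repeat' split) <;> omega

lemma QQ_sub (n : ℕ) (hn : Odd n) (h7 : 7 ≤ n) (x : Fin n) (S : Set (Fin n)) (hx : x ∉ S) :
    IsMatchingOn (QQrel n) S := by
  have hn2 : n % 2 = 1 := Nat.odd_iff.mp hn
  have hne : ∀ u ∈ S, u.val ≠ x.val := by
    intro u hu h
    exact hx (Fin.ext h ▸ hu)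
  by_cases hxm : x.val ≤ n - 3
  · refine isMatchingOn_of_pos _ S (posPath n x.val) (matePath n x.val) ?_ ?_
    · intro u hu v hv
      have := hne u hu; have := hne v hv
      have := u.isLt; have := v.isLt
      unfold posPath posL posR
      split_ifs <;> omega
    · intro u hu v hv h1 h2
      exact path_mate n x.val u.val v.val hn2 h7 hxm u.isLt v.isLt (hne u hu) (hne v hv) h1 h2
  · refine isMatchingOn_of_pos _ S (posEnd n) (mateEnd n) ?_ ?_
    · intro u hu v hv
      have := hne u hu; have := hne v hv
      have := u.isLt; have := v.isLt
      unfold posEnd posL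
      split_ifs <;> omega
    · intro u hu v hv h1 h2
      exact end_mate n x.val u.val v.val hn2 h7 (by omega) x.isLt u.isLt v.isLt
        (hne u hu) (hne v hv) h1 h2

lemma QQ_not (n : ℕ) (hn : Odd n) (h7 : 7 ≤ n) : ¬ IsMatchingOn (QQrel n) Set.univ := by
  have hn2 : n % 2 = 1 := Nat.odd_iff.mp hn
  rintro ⟨m, e, hb, hm⟩
  have hsurj : ∀ k : ℕ, ∃ i : Fin m, ∀ h : k < n, e i = ⟨k, h⟩ := by
    intro k
    by_cases h : k < n
    · obtain ⟨i, -, hi⟩ := hb.2.2 (Set.mem_univ (⟨k, h⟩ : Fin n))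
      exact ⟨i, fun _ => hi⟩
    · obtain ⟨i, -, hi⟩ := hb.2.2 (Set.mem_univ (⟨0, by omega⟩ : Fin n))
      exact ⟨i, fun h' => absurd h' h⟩
  choose p hp using hsurj
  have hinj : ∀ a b, a < n → b < n → p a = p b → a = b := by
    intro a b ha hb' h
    have h1 := hp a ha
    have h2 := hp b hb'
    rw [h, h2] at h1
    exact (Fin.mk.inj h1).symm
  let E : ℕ → ℕ → Prop := fun i j => (i < j ∧ ¬ Qback n i j) ∨ (j < i ∧ Qback n j i)
  let B : ℕ → ℕ → Prop := fun u v => (p u < p v ∧ E v u) ∨ (p v < p u ∧ E u v)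
  have huniq : ∀ u v w, u < n → v < n → w < n → B u v → B u w → v = w := by
    intro u v w hu hv hw h1 h2
    apply hinj v w hv hw
    apply hm (p u)
    · simpa [QQrel, hp u hu, hp v hv] using h1
    · simpa [QQrel, hp u hu, hp w hw] using h2
  have hne : ∀ a b, a < n → b < n → a ≠ b → p a < p b ∨ p b < p a := by
    intro a b ha hb' h
    exact lt_or_gt_of_ne (fun h' => h (hinj a b ha hb' h'))
  have hout : ∀ u v w, u < n → v < n → w < n → B u v → v ≠ w → u ≠ w → E u w → p u < p w := by
    intro u v w hu hv hw h1 h2 h3 h4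
    rcases hne u w hu hw h3 with h | h
    · exact h
    · exact absurd (huniq u v w hu hv hw h1 (Or.inr ⟨h, h4⟩)) h2
  have hin : ∀ u v w, u < n → v < n → w < n → B u v → v ≠ w → u ≠ w → E w u → p w < p u := by
    intro u v w hu hv hw h1 h2 h3 h4
    rcases hne u w hu hw h3 with h | h
    · exact absurd (huniq u v w hu hv hw h1 (Or.inl ⟨h, h4⟩)) h2
    · exact h
  have hE : ∀ i j, E i j ↔ (i < j ∧ ¬ Qback n i j) ∨ (j < i ∧ Qback n j i) := fun _ _ => Iff.rfl
  have hfirst : p 1 < p 2 := by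
    have hm0 : 0 < m := (p 0).pos
    obtain ⟨z, hz⟩ : ∃ z : Fin n, e ⟨0, hm0⟩ = z := ⟨_, rfl⟩
    have hpz : p z.val = ⟨0, hm0⟩ := by
      apply hb.2.1 (Set.mem_univ _) (Set.mem_univ _)
      rw [hz, hp z.val z.isLt]
    have hmin : ∀ w, w < n → w ≠ z.val → p z.val < p w := by
      intro w hw hwz
      rcases hne w z.val hw z.isLt hwz with h | h
      · rw [hpz] at h
        exact absurd h (by simp [Fin.lt_def])
      · exact h
    have hno : ∀ v w, v < n → w < n → v ≠ w → v ≠ z.val → w ≠ z.val → E v z.val → E w z.val →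
        False := by
      intro v w hv hw hvw hvz hwz h1 h2
      exact hvw (huniq z.val v w z.isLt hv hw (Or.inl ⟨hmin v hv hvz, h1⟩)
        (Or.inl ⟨hmin w hw hwz, h2⟩))
    have hz1 : z.val = 1 := by
      have hzn := z.isLt
      by_contra hz1
      generalize z.val = z at *
      by_cases hz0 : z = 0
      · exact hno 1 (n-2) (by omega) (by omega) (by omega) (by omega) (by omega)
          (by rw [hE]; unfold Qback; omega) (by rw [hE]; unfold Qback; omega)
      by_cases hz2 : z = 2
      · exact hno 0 3 (by omega) (by omega) (by omega) (by omega) (by omega)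
          (by rw [hE]; unfold Qback; omega) (by rw [hE]; unfold Qback; omega)
      by_cases hz3 : z = n - 2
      · exact hno 1 2 (by omega) (by omega) (by omega) (by omega) (by omega)
          (by rw [hE]; unfold Qback; omega) (by rw [hE]; unfold Qback; omega)
      exact hno 0 1 (by omega) (by omega) (by omega) (by omega) (by omega)
          (by rw [hE]; unfold Qback; omega) (by rw [hE]; unfold Qback; omega)
    rw [← hz1]
    exact hmin 2 (by omega) (by omega)
  have hB2 : ∀ k, 2 * k + 2 ≤ n - 3 → p (2 * k + 1) < p (2 * k + 2) → B (2 * k + 2) (2 * k + 1) := by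
    intro k hk h
    exact Or.inr ⟨h, by rw [hE]; unfold Qback; omega⟩
  have hind : ∀ k, 2 * k + 2 ≤ n - 3 → p (2 * k + 1) < p (2 * k + 2) := by
    intro k
    induction k with
    | zero => intro _; exact hfirst
    | succ k ih =>
      intro hk
      have hB := hB2 k (by omega) (ih (by omega))
      have h1 : p (2 * k + 3) < p (2 * k + 2) :=
        hin _ _ _ (by omega) (by omega) (by omega) hB (by omega) (by omega)
          (by rw [hE]; unfold Qback; omega)
      have h2 : p (2 * k + 2) < p (2 * k + 4) :=
        hout _ _ _ (by omega) (by omega) (by omega) hB (by omega) (by omega)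
          (by rw [hE]; unfold Qback; omega)
      exact h1.trans h2
  have ha0 : B (n - 2) 0 := by
    have hB := hB2 0 (by omega) hfirst
    have h1 : p 0 < p 2 := hin _ _ _ (by omega) (by omega) (by omega) hB (by omega) (by omega)
          (by rw [hE]; unfold Qback; omega)
    have h2 : p 2 < p (n - 2) := hout _ _ _ (by omega) (by omega) (by omega) hB (by omega) (by omega)
          (by rw [hE]; unfold Qback; omega)
    exact Or.inr ⟨h1.trans h2, by rw [hE]; unfold Qback; omega⟩
  obtain ⟨k, hk⟩ : ∃ k, 2 * k + 2 = n - 3 := ⟨(n - 5) / 2, by omega⟩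
  have hab : B (n - 2) (n - 1) := by
    have hB := hB2 k (by omega) (hind k (by omega))
    have h1 : p (n - 1) < p (2 * k + 2) :=
      hin _ _ _ (by omega) (by omega) (by omega) hB (by omega) (by omega)
          (by rw [hE]; unfold Qback; omega)
    have h2 : p (2 * k + 2) < p (n - 2) :=
      hout _ _ _ (by omega) (by omega) (by omega) hB (by omega) (by omega)
          (by rw [hE]; unfold Qback; omega)
    exact Or.inr ⟨h1.trans h2, by rw [hE]; unfold Qback; omega⟩
  have := huniq (n - 2) 0 (n - 1) (by omega) (by omega) (by omega) ha0 hab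
  omega

lemma QQ_main (n : ℕ) (hn : Odd n) (h7 : 7 ≤ n) :
    ¬ IsMatchingOn (QQrel n) Set.univ ∧
      ∀ S : Set (Fin n), S.Nonempty → S.ncard < n → IsMatchingOn (QQrel n) S := by
  refine ⟨QQ_not n hn h7, fun S _ hS => ?_⟩
  have : ∃ x, x ∉ S := by
    by_contra! h
    have hu : S = Set.univ := Set.eq_univ_of_forall h
    rw [hu, Set.ncard_univ, Nat.card_eq_fintype_card, Fintype.card_fin] at hS
    exact lt_irrefl _ hS
  obtain ⟨x, hx⟩ := this
  exact QQ_sub n hn h7 x S hx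

/-- For every odd `n ≥ 7`, `Q_n` is a minimal non-matching tournament (it is not a
matching tournament but all its proper subtournaments are); consequently there are
infinitely many pairwise non-isomorphic minimal non-matching tournaments (arbitrarily
large ones, which in particular are pairwise non-isomorphic). -/
theorem stmt15 :
    (∀ n : ℕ, Odd n → 7 ≤ n →
      ¬ IsMatchingOn (QQrel n) Set.univ ∧
        ∀ S : Set (Fin n), S.Nonempty → S.ncard < n → IsMatchingOn (QQrel n) S) ∧
    (∀ N : ℕ, ∃ n : ℕ, N ≤ n ∧ ∃ T : Tournament (Fin n),
      ¬ IsMatchingOn T.rel Set.univ ∧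
        ∀ S : Set (Fin n), S.Nonempty → S.ncard < n → IsMatchingOn T.rel S) := by
  refine ⟨QQ_main, fun N => ⟨2 * N + 7, by omega, ⟨QQrel _, ?_, ?_⟩, QQ_main _ ⟨N + 3, by ring⟩ (by omega)⟩⟩
  · rintro u v (⟨h1, h2⟩ | ⟨h1, h2⟩) (⟨h3, h4⟩ | ⟨h3, h4⟩)
    · omega
    · exact h2 h4
    · exact h4 h2
    · omega
  · intro u v h
    have h' : u.val ≠ v.val := fun h' => h (Fin.ext h')
    unfold QQrel
    rcases lt_or_gt_of_ne h' with h1 | h1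
    · by_cases h2 : Qback (2 * N + 7) u.val v.val
      · exact Or.inr (Or.inr ⟨h1, h2⟩)
      · exact Or.inl (Or.inl ⟨h1, h2⟩)
    · by_cases h2 : Qback (2 * N + 7) v.val u.val
      · exact Or.inl (Or.inr ⟨h1, h2⟩)
      · exact Or.inr (Or.inl ⟨h1, h2⟩)
end

section
/- For each n ≥ 3, there exists k such that if a tournament G has no subtournament isomorphic to J_n, then V(G) has an ordering v_1,…,v_{|V(G)|} that has no backedge of length greater than k. -/
namespace Tournament

open scoped Classical in
/-- Some vertex of `A` has out-degree inside `A` at least `(|A|-1)/2`. -/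
theorem exists_half_out {V : Type} (T : Tournament V) (A : Finset V) (hA : A.Nonempty) :
    ∃ y ∈ A, A.card ≤ 2 * (A.filter (fun w => T.rel y w)).card + 1 := by
  by_contra hcon
  push Not at hcon
  have hsum : ∑ y ∈ A, (A.filter (fun w => T.rel y w)).card
      = ∑ y ∈ A, (A.filter (fun w => T.rel w y)).card :=
    Finset.sum_card_bipartiteAbove_eq_sum_card_bipartiteBelow T.rel
  have hlt : ∑ y ∈ A, (A.filter (fun w => T.rel y w)).card
      < ∑ y ∈ A, (A.filter (fun w => T.rel w y)).card := by
    refine Finset.sum_lt_sum_of_nonempty hA fun y hy => ?_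
    have h1 := hcon y hy
    have h2 : A ⊆ insert y (A.filter (fun w => T.rel y w) ∪ A.filter (fun w => T.rel w y)) := by
      intro w hw
      by_cases hwy : w = y
      · simp [hwy]
      · rcases T.total w y hwy with h | h <;> simp [hw, h]
    have h3 := Finset.card_le_card h2
    have h4 := Finset.card_insert_le y
      (A.filter (fun w => T.rel y w) ∪ A.filter (fun w => T.rel w y))
    have h5 := Finset.card_union_le (A.filter (fun w => T.rel y w)) (A.filter (fun w => T.rel w y))
    omega
  omega

/-- The reverse tournament. -/
def rev {V : Type} (T : Tournament V) : Tournament V where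
  rel u v := T.rel v u
  asymm u v h := T.asymm v u h
  total u v h := T.total v u h.symm

/-- A set of `2^m` vertices contains a transitive tournament on `m` vertices. -/
theorem exists_trans {V : Type} (T : Tournament V) (m : ℕ) : ∀ A : Finset V, 2 ^ m ≤ A.card →
    ∃ l : List V, l.length = m ∧ l.Pairwise T.rel ∧ ∀ x ∈ l, x ∈ A := by
  classical
  induction m with
  | zero => intro A _; exact ⟨[], by simp⟩
  | succ m ih =>
    intro A hA
    have hpos : 0 < 2 ^ m := by positivity
    rw [pow_succ] at hA
    obtain ⟨y, hy, hc⟩ := T.exists_half_out A (Finset.card_pos.mp (by omega))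
    obtain ⟨l, h1, h2, h3⟩ := ih (A.filter (fun w => T.rel y w)) (by
      have : A.card ≤ 2 * (A.filter (fun w => T.rel y w)).card + 1 := by convert hc
      omega)
    refine ⟨y :: l, by simp [h1], ?_, ?_⟩
    · rw [List.pairwise_cons]
      exact ⟨fun a ha => (Finset.mem_filter.mp (h3 a ha)).2, h2⟩
    · intro x hx
      rcases List.mem_cons.mp hx with rfl | hx
      · exact hy
      · exact (Finset.mem_filter.mp (h3 x hx)).1

theorem hasSub_JJ {V : Type} (T : Tournament V) (n : ℕ) (hn : 3 ≤ n) (u v : V) (hvu : T.rel v u)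
    (l : List V) (hl : l.length = n - 2) (hp : l.Pairwise T.rel)
    (hm : ∀ x ∈ l, T.rel u x ∧ T.rel x v) : T.HasSub (JJrel n) := by
  let f : Fin n → V := fun i =>
    if h0 : i.val = 0 then u else if h1 : i.val = n - 1 then v else l[i.val - 1]'(by omega)
  have irr : ∀ x, ¬ T.rel x x := fun x h => T.asymm x x h h
  have key : ∀ i j : Fin n, JJrel n i j → T.rel (f i) (f j) := by
    intro i j hij
    have hi := i.isLt
    have hj := j.isLt
    unfold JJrel at hij
    simp only [f]
    split_ifs with a b c d e g k
    · omega
    · omega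
    · exact (hm _ (List.getElem_mem _)).1
    · exact hvu
    · omega
    · omega
    · omega
    · exact (hm _ (List.getElem_mem _)).2
    · exact List.pairwise_iff_getElem.mp hp _ _ _ _ (by omega)
  have tot : ∀ i j : Fin n, i ≠ j → JJrel n i j ∨ JJrel n j i := by
    intro i j hij
    have hi := i.isLt
    have hj := j.isLt
    have : i.val ≠ j.val := fun h => hij (Fin.ext h)
    unfold JJrel
    omega
  refine ⟨f, ?_, ?_⟩
  · intro i j hij
    by_contra hne
    rcases tot i j hne with h | h
    · have := key _ _ h
      rw [hij] at this
      exact irr _ this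
    · have := key _ _ h
      rw [hij] at this
      exact irr _ this
  · intro i j
    refine ⟨key i j, fun h => ?_⟩
    by_cases hne : i = j
    · subst hne
      exact absurd h (irr _)
    · rcases tot i j hne with h' | h'
      · exact h'
      · exact absurd (key _ _ h') (T.asymm _ _ h)

open scoped Classical in
/-- A set of vertices whose in-neighbourhoods are pairwise close is small. -/
theorem card_le_of_close {V : Type} [Fintype V] (T : Tournament V) (D : ℕ) (S : Finset V)
    (hS : ∀ x ∈ S, ∀ y ∈ S,
      (Finset.univ.filter (fun w => T.rel w x ∧ ¬ T.rel w y)).card ≤ D) :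
    S.card ≤ 4 * D + 2 := by
  rcases S.eq_empty_or_nonempty with rfl | ⟨x, hx⟩
  · simp
  have hsplit := Finset.card_filter_add_card_filter_not (s := S) (fun w => T.rel w x)
  have hA : (S.filter (fun w => T.rel w x)).card ≤ 2 * D + 1 := by
    rcases (S.filter (fun w => T.rel w x)).eq_empty_or_nonempty with h | h
    · simp [h]
    obtain ⟨y, hy, hc⟩ := T.exists_half_out _ h
    have h2 := hS x hx y (Finset.mem_filter.mp hy).1
    have h3 := Finset.card_le_card (s := (S.filter (fun w => T.rel w x)).filter (fun w => T.rel y w))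
      (t := Finset.univ.filter (fun w => T.rel w x ∧ ¬ T.rel w y)) (by
        intro w hw
        simp only [Finset.mem_filter, Finset.mem_univ, true_and] at hw ⊢
        exact ⟨hw.1.2, T.asymm _ _ hw.2⟩)
    omega
  have hB : (S.filter (fun w => ¬ T.rel w x)).card ≤ 2 * D + 1 := by
    rcases (S.filter (fun w => ¬ T.rel w x)).eq_empty_or_nonempty with h | h
    · simp [h]
    obtain ⟨y, hy, hc⟩ := T.rev.exists_half_out _ h
    have h2 := hS y (Finset.mem_filter.mp hy).1 x hx
    have h3 := Finset.card_le_card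
      (s := (S.filter (fun w => ¬ T.rel w x)).filter (fun w => T.rev.rel y w))
      (t := Finset.univ.filter (fun w => T.rel w y ∧ ¬ T.rel w x)) (by
        intro w hw
        simp only [Finset.mem_filter, Finset.mem_univ, true_and] at hw ⊢
        exact ⟨hw.2, hw.1.2⟩)
    omega
  omega

end Tournament

/-- For each `n ≥ 3` there exists `k` such that every tournament with no subtournament
isomorphic to `J_n` has an ordering of its vertices with no backedge of length `> k`. -/
theorem stmt16 (n : ℕ) (hn : 3 ≤ n) :
    ∃ k : ℕ, ∀ (V : Type) [Fintype V] (T : Tournament V),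
      ¬ T.HasSub (JJrel n) →
      ∃ (m : ℕ) (e : Fin m → V), Function.Bijective e ∧
        ∀ i j : Fin m, i < j → T.rel (e j) (e i) → j.val - i.val ≤ k := by
  classical
  refine ⟨8 * 2 ^ (n - 2) + 2, fun V _ T hJ => ?_⟩
  set R := 2 ^ (n - 2) with hR
  let d : V → ℕ := fun v => (Finset.univ.filter (fun w => T.rel w v)).card
  -- the triangle bound: `v → u` lies in few cyclic triangles
  have tri : ∀ u v, T.rel v u →
      (Finset.univ.filter (fun w => T.rel w v ∧ ¬ T.rel w u)).card ≤ R := by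
    intro u v hvu
    by_contra hcon
    push Not at hcon
    obtain ⟨l, h1, h2, h3⟩ := T.exists_trans (n - 2) _ hcon.le
    refine hJ (T.hasSub_JJ n hn u v hvu l h1 h2 fun x hx => ?_)
    have hx' := h3 x hx
    simp only [Finset.mem_filter, Finset.mem_univ, true_and] at hx'
    have hne : x ≠ u := by
      rintro rfl
      exact T.asymm _ _ hvu hx'.1
    exact ⟨(T.total x u hne).resolve_left hx'.2, hx'.1⟩
  have diff : ∀ x y, d x + (Finset.univ.filter (fun w => T.rel w y ∧ ¬ T.rel w x)).card
      = d y + (Finset.univ.filter (fun w => T.rel w x ∧ ¬ T.rel w y)).card := by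
    intro x y
    have e1 := Finset.card_filter_add_card_filter_not
      (s := Finset.univ.filter (fun w => T.rel w x)) (fun w => T.rel w y)
    have e2 := Finset.card_filter_add_card_filter_not
      (s := Finset.univ.filter (fun w => T.rel w y)) (fun w => T.rel w x)
    simp only [Finset.filter_filter] at e1 e2
    have e3 : (Finset.univ.filter (fun w => T.rel w x ∧ T.rel w y))
        = (Finset.univ.filter (fun w => T.rel w y ∧ T.rel w x)) := by
      ext w
      simp [and_comm]
    rw [e3] at e1
    simp only [d]
    omega
  let f0 : Fin (Fintype.card V) ≃ V := (Fintype.equivFin V).symm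
  let σ := Tuple.sort (fun i => d (f0 i))
  have mono : Monotone (fun i => d (f0 (σ i))) := Tuple.monotone_sort (fun i => d (f0 i))
  refine ⟨Fintype.card V, fun i => f0 (σ i), (σ.trans f0).bijective, fun i j hij hback => ?_⟩
  have hdij : d (f0 (σ j)) ≤ d (f0 (σ i)) + R := by
    have h1 := tri (f0 (σ i)) (f0 (σ j)) hback
    have h2 := diff (f0 (σ i)) (f0 (σ j))
    omega
  let S : Finset V := (Finset.Icc i j).map (σ.trans f0).toEmbedding
  have hSd : ∀ x ∈ S, d (f0 (σ i)) ≤ d x ∧ d x ≤ d (f0 (σ j)) := by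
    intro x hx
    obtain ⟨k, hk, rfl⟩ := Finset.mem_map.mp hx
    rw [Finset.mem_Icc] at hk
    exact ⟨mono hk.1, mono hk.2⟩
  have hclose := T.card_le_of_close (2 * R) S (by
    intro x hx y hy
    have hdx := hSd x hx
    have hdy := hSd y hy
    by_cases hxy : x = y
    · subst hxy
      simp
    have h2 := diff x y
    rcases T.total x y hxy with h | h
    · have := tri _ _ h
      omega
    · have := tri _ _ h
      omega)
  have hcard : S.card = j.val + 1 - i.val := by
    simp [S]
  omega
end

section
/- For each k ≥ 1, there exists n such that if a tournament G has an ordering v_1,…,v_{|V(G)|} of its vertices with no backedge of length greater than k, then G has no subtournament isomorphic to J_n. (In fact n = 10k suffices.) -/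
/-- For each `k ≥ 1` there exists `n` such that every tournament having an ordering of
its vertices with no backedge of length `> k` has no subtournament isomorphic to `J_n`. -/
theorem stmt17 (k : ℕ) (hk : 1 ≤ k) :
    ∃ n : ℕ, 3 ≤ n ∧ ∀ (V : Type) [Fintype V] (T : Tournament V)
      (m : ℕ) (e : Fin m → V), Function.Bijective e →
      (∀ i j : Fin m, i < j → T.rel (e j) (e i) → j.val - i.val ≤ k) →
      ¬ T.HasSub (JJrel n) := by
  refine ⟨10 * k, by omega, ?_⟩
  intro V _ T m e he hback ⟨f, hf, hrel⟩
  choose p hp using fun i => he.2 (f i)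
  have hpinj : Function.Injective (fun i => (p i).val) := by
    intro a b hab
    have : p a = p b := Fin.ext hab
    apply hf
    rw [← hp a, ← hp b, this]
  have key : ∀ i j, JJrel (10 * k) i j → (p i).val ≤ (p j).val + k := by
    intro i j h
    by_contra hlt
    push Not at hlt
    have h2 := hback (p j) (p i) (Fin.lt_def.2 (by omega))
      (by rw [hp, hp]; exact (hrel i j).1 h)
    omega
  let a : Fin (10 * k) := ⟨0, by omega⟩
  let z : Fin (10 * k) := ⟨10 * k - 1, by omega⟩
  have hza := key z a (Or.inr ⟨rfl, rfl⟩)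
  have hmid : ∀ i : Fin (10 * k), i.val ≠ 0 → i.val ≠ 10 * k - 1 →
      (p a).val ≤ (p i).val + k ∧ (p i).val ≤ (p z).val + k := by
    intro i h0 h1
    have hi := i.isLt
    exact ⟨key a i (Or.inl ⟨by simp only [a]; omega, fun h => h1 h.2⟩),
      key i z (Or.inl ⟨by simp only [z]; omega, fun h => h0 h.1⟩)⟩
  have h1 := hmid ⟨1, by omega⟩ (by simp) (by simp only; omega)
  have hmem : ∀ i ∈ (Finset.univ : Finset (Fin (10 * k))),
      (p i).val ∈ Finset.Icc ((p a).val - 2 * k) ((p a).val + 2 * k) := by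
    intro i _
    rw [Finset.mem_Icc]
    by_cases h0 : i.val = 0
    · have : i = a := Fin.ext h0
      subst this
      omega
    · by_cases hl : i.val = 10 * k - 1
      · have : i = z := Fin.ext hl
        subst this
        omega
      · have := hmid i h0 hl
        omega
  have hcard := Finset.card_le_card_of_injOn (fun i => (p i).val) hmem hpinj.injOn
  rw [Finset.card_univ, Fintype.card_fin, Nat.card_Icc] at hcard
  omega
end
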